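/- For all i, j ∈ I and all integers u, v with 0 ≤ u ≤ N and −h ≤ v ≤ 0, the double-expansion coefficients of the inverse (q,t)-deformed Cartan matrix satisfy the palindromic symmetry c̃_{ij}(N − u, −h − v) = c̃_{i j^*}(u, v). -/

import Mathlib

noncomputable section

open scoped BigOperators

/-- The field `K = ℚ(q,t)` of rational functions in two variables over `ℚ`. -/
abbrev KK : Type := FractionRing (MvPolynomial (Fin 2) ℚ)

/-- The variable `q` of `ℚ(q,t)`. -/
def qv : KK := algebraMap (MvPolynomial (Fin 2) ℚ) KK (MvPolynomial.X 0)

/-- The variable `t` of `ℚ(q,t)`. -/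
def tv : KK := algebraMap (MvPolynomial (Fin 2) ℚ) KK (MvPolynomial.X 1)

/-- The quantum integer `[k]_q = (q^k - q^{-k})/(q - q⁻¹)` in `ℚ(q,t)`. -/
def qint (k : ℤ) : KK := (qv ^ k - qv ^ (-k)) / (qv - qv⁻¹)

variable {I : Type}

/-- The `(q,t)`-deformed Cartan matrix `C(q,t)`:
`C_{ii} = q^{d_i} t⁻¹ + q^{-d_i} t` and `C_{ij} = [c_{ij}]_q` for `i ≠ j`. -/
def Cqt [DecidableEq I] (c : I → I → ℤ) (d : I → ℤ) (i j : I) : KK :=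
  if i = j then qv ^ (d i) * tv⁻¹ + qv ^ (-(d i)) * tv else qint (c i j)

/-- The basis vector `α_i` of `V = K^{⊕I}`. -/
def alphaK [DecidableEq I] (i : I) : I → KK := Pi.single i 1

/-- The deformed bilinear form `B` on `V`, determined by
`B(α_i, α_j) = [d_i]_q C_{ij}(q,t)`. -/
def Bform [Fintype I] [DecidableEq I] (c : I → I → ℤ) (d : I → ℤ)
    (lam mu : I → KK) : KK :=
  ∑ i, ∑ j, lam i * mu j * (qint (d i) * Cqt c d i j)

/-- The operator `T_i : V → V`, `T_i(λ) = λ - (q^{-d_i} t/[d_i]_q)·B(α_i, λ)·α_i`. -/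
def Trefl [Fintype I] [DecidableEq I] (c : I → I → ℤ) (d : I → ℤ) (i : I)
    (lam : I → KK) : I → KK :=
  fun k => lam k - (qv ^ (-(d i)) * tv / qint (d i)) * Bform c d (alphaK i) lam * alphaK i k

/-- The simple reflection `s_i` on the root lattice `ℤ^{⊕I}`, with `s_i(α_j) = α_j - c_{ij} α_i`. -/
def sZ [Fintype I] [DecidableEq I] (c : I → I → ℤ) (i : I) : (I → ℤ) → (I → ℤ) :=
  fun v k => v k - (if k = i then ∑ j, c i j * v j else 0)

/-- The simple root `α_i` of the root lattice `ℤ^{⊕I}`. -/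
def alphaZ [DecidableEq I] (i : I) : I → ℤ := Pi.single i 1

/-- Membership in the Weyl group `W`, the group of automorphisms of the root lattice
generated by the simple reflections; since each simple reflection is an involution,
`W` is exactly the set of finite products of simple reflections. -/
def memW [Fintype I] [DecidableEq I] (c : I → I → ℤ) (w : (I → ℤ) → (I → ℤ)) : Prop :=
  ∃ l : List I, w = (l.map (sZ c)).foldr (· ∘ ·) id

/-- The field `ℚ((q))` of formal Laurent series. -/
abbrev FF : Type := LaurentSeries ℚ

/-- The field `ℚ((q))((t⁻¹))` of iterated formal Laurent series: the outer variable is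
`s = t⁻¹`, so that Laurent expansion in `t⁻¹` (expansion at `t = ∞`) followed by Laurent
expansion at `q = 0` lands in this field. -/
abbrev LL : Type := LaurentSeries FF

/-- The image of `q` in `ℚ((q))((t⁻¹))`. -/
def qL : LL := HahnSeries.C (HahnSeries.single (1 : ℤ) (1 : ℚ))

/-- The image of `t` in `ℚ((q))((t⁻¹))`: the inverse `s⁻¹` of the outer variable,
i.e. the monomial with outer exponent `-1`. -/
def tL : LL := HahnSeries.single (-1 : ℤ) (1 : FF)

/-- The coefficient of `q^u t^v` of an element of `ℚ((q))((t⁻¹))` (the coefficient of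
`t^v`, i.e. of outer exponent `-v`, is a Laurent series in `q`, of which we take the
coefficient of `q^u`). -/
def dcoeff (x : LL) (u v : ℤ) : ℚ := (x.coeff (-v)).coeff u

set_option linter.unusedSectionVars false
set_option linter.unusedVariables false

/-! ### Words acting on the root lattice -/

/-- pairing with the simple coroot -/
def prZ [Fintype I] (c : I → I → ℤ) (i : I) (x : I → ℤ) : ℤ := ∑ j, c i j * x j

/-- action of a word -/
def actW [Fintype I] [DecidableEq I] (c : I → I → ℤ) : List I → (I → ℤ) → (I → ℤ)
  | [], x => x
  | i :: l, x => sZ c i (actW c l x)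

/-- symmetrized integral form -/
def BZ [Fintype I] (c : I → I → ℤ) (d : I → ℤ) (x y : I → ℤ) : ℤ :=
  ∑ i, x i * (d i * prZ c i y)

/-- the standing hypotheses -/
structure CD [Fintype I] [DecidableEq I] (c : I → I → ℤ) (d : I → ℤ) (r : ℤ) : Prop where
  hdiag : ∀ i, c i i = 2
  hoff : ∀ i j, i ≠ j → c i j ≤ 0
  hdpos : ∀ i, 0 < d i
  hsymm : ∀ i j, d i * c i j = d j * c j i
  honer : ∀ i, d i = 1 ∨ d i = r
  hrmax : ∀ i, d i ≤ r
  hrmem : ∃ i, d i = r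
  hbmax : ∀ i j, i ≠ j → c i j ≠ 0 → d i * c i j = -(max (d i) (d j))
  hconn : ∀ i j : I, Relation.ReflTransGen (fun a b => a ≠ b ∧ c a b ≠ 0) i j
  hWfin : {w : (I → ℤ) → (I → ℤ) | memW c w}.Finite

section
variable [Fintype I] [DecidableEq I] {c : I → I → ℤ} {d : I → ℤ} {r : ℤ}

theorem memW_iff (w : (I → ℤ) → (I → ℤ)) : memW c w ↔ ∃ l, w = actW c l := by
  have key : ∀ l : List I, (l.map (sZ c)).foldr (· ∘ ·) id = actW c l := by
    intro l
    induction l with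
    | nil => funext x; rfl
    | cons i l ih => funext x; simp only [List.map_cons, List.foldr_cons, ih, actW, Function.comp]
  unfold memW
  constructor
  · rintro ⟨l, rfl⟩; exact ⟨l, key l⟩
  · rintro ⟨l, rfl⟩; exact ⟨l, (key l).symm⟩

theorem sZ_eq (i : I) (x : I → ℤ) : sZ c i x = x - prZ c i x • alphaZ i := by
  funext k
  by_cases h : k = i
  · subst h; simp [sZ, alphaZ, prZ]
  · simp [sZ, alphaZ, h]

theorem prZ_add (i : I) (x y : I → ℤ) : prZ c i (x + y) = prZ c i x + prZ c i y := by
  simp [prZ, mul_add, Finset.sum_add_distrib]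

theorem prZ_smul (i : I) (a : ℤ) (x : I → ℤ) : prZ c i (a • x) = a * prZ c i x := by
  simp only [prZ, Finset.mul_sum, Pi.smul_apply, smul_eq_mul]
  exact Finset.sum_congr rfl fun j _ => by ring

theorem prZ_alpha (i j : I) : prZ c i (alphaZ j) = c i j := by
  simp [prZ, alphaZ, Pi.single_apply]

theorem prZ_neg (i : I) (x : I → ℤ) : prZ c i (-x) = - prZ c i x := by
  simp [prZ]

theorem prZ_sub (i : I) (x y : I → ℤ) : prZ c i (x - y) = prZ c i x - prZ c i y := by
  rw [sub_eq_add_neg, prZ_add, prZ_neg]; ring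

theorem sZ_add (i : I) (x y : I → ℤ) : sZ c i (x + y) = sZ c i x + sZ c i y := by
  simp only [sZ_eq, prZ_add]; module

theorem sZ_smul (i : I) (a : ℤ) (x : I → ℤ) : sZ c i (a • x) = a • sZ c i x := by
  simp only [sZ_eq, prZ_smul]; module

theorem act_add (l : List I) (x y : I → ℤ) : actW c l (x + y) = actW c l x + actW c l y := by
  induction l with
  | nil => rfl
  | cons i l ih => simp only [actW, ih, sZ_add]

theorem act_smul (l : List I) (a : ℤ) (x : I → ℤ) : actW c l (a • x) = a • actW c l x := by
  induction l with
  | nil => rfl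
  | cons i l ih => simp only [actW, ih, sZ_smul]

theorem act_neg (l : List I) (x : I → ℤ) : actW c l (-x) = - actW c l x := by
  have := act_smul (c := c) l (-1) x
  simpa using this

theorem act_sub (l : List I) (x y : I → ℤ) : actW c l (x - y) = actW c l x - actW c l y := by
  rw [sub_eq_add_neg, act_add, act_neg, sub_eq_add_neg]

theorem act_zero (l : List I) : actW c l 0 = 0 := by
  have := act_smul (c := c) l 0 0
  simpa using this

theorem vec_decomp (x : I → ℤ) : x = ∑ k, x k • alphaZ k := by
  funext j
  simp [alphaZ, Finset.sum_apply, Pi.single_apply]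

theorem act_sum {J : Type} (l : List I) (s : Finset J) (g : J → I → ℤ) :
    actW c l (∑ k ∈ s, g k) = ∑ k ∈ s, actW c l (g k) := by
  classical
  induction s using Finset.induction_on with
  | empty => simp [act_zero]
  | insert a s ha ih => rw [Finset.sum_insert ha, Finset.sum_insert ha, act_add, ih]

theorem act_decomp (l : List I) (x : I → ℤ) :
    actW c l x = ∑ k, x k • actW c l (alphaZ k) := by
  conv_lhs => rw [vec_decomp x, act_sum]
  exact Finset.sum_congr rfl fun k _ => act_smul _ _ _

theorem act_append (l m : List I) (x : I → ℤ) : actW c (l ++ m) x = actW c l (actW c m x) := by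
  induction l with
  | nil => rfl
  | cons i l ih => simp only [List.cons_append, actW, ih]

theorem act_single (i : I) (x : I → ℤ) : actW c [i] x = sZ c i x := rfl

namespace CD

theorem s_alpha (H : CD c d r) (i : I) : sZ c i (alphaZ i) = - alphaZ i := by
  rw [sZ_eq, prZ_alpha, H.hdiag]; module

theorem s_s (H : CD c d r) (i : I) (x : I → ℤ) : sZ c i (sZ c i x) = x := by
  rw [sZ_eq i (sZ c i x), sZ_eq i x, prZ_sub, prZ_smul, prZ_alpha, H.hdiag]; module

theorem act_rev (H : CD c d r) (l : List I) (x : I → ℤ) : actW c l (actW c l.reverse x) = x := by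
  induction l generalizing x with
  | nil => rfl
  | cons i l ih => simp only [List.reverse_cons, act_append, actW, ih, H.s_s]

theorem rev_act (H : CD c d r) (l : List I) (x : I → ℤ) : actW c l.reverse (actW c l x) = x := by
  have := H.act_rev l.reverse x
  rwa [List.reverse_reverse] at this

theorem rev_congr (H : CD c d r) {l m : List I} (h : actW c l = actW c m) :
    actW c l.reverse = actW c m.reverse := by
  funext x
  have : actW c m (actW c l.reverse x) = x := by rw [← h, H.act_rev]
  conv_rhs => rw [← this, H.rev_act]

theorem B_alpha_left (H : CD c d r) (i : I) (x : I → ℤ) : BZ c d (alphaZ i) x = d i * prZ c i x := by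
  simp [BZ, alphaZ, Pi.single_apply]

theorem B_add_right (H : CD c d r) (x y z : I → ℤ) : BZ c d x (y + z) = BZ c d x y + BZ c d x z := by
  simp [BZ, prZ_add, mul_add, Finset.sum_add_distrib]

theorem B_smul_right (H : CD c d r) (a : ℤ) (x y : I → ℤ) : BZ c d x (a • y) = a * BZ c d x y := by
  simp only [BZ, prZ_smul, Finset.mul_sum]
  exact Finset.sum_congr rfl fun j _ => by ring

theorem B_comm (H : CD c d r) (x y : I → ℤ) : BZ c d x y = BZ c d y x := by
  simp only [BZ, prZ, Finset.mul_sum]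
  rw [Finset.sum_comm]
  refine Finset.sum_congr rfl fun j _ => Finset.sum_congr rfl fun i _ => ?_
  linear_combination (x i * y j) * H.hsymm i j

theorem B_add_left (H : CD c d r) (x y z : I → ℤ) : BZ c d (x + y) z = BZ c d x z + BZ c d y z := by
  rw [H.B_comm, H.B_add_right, H.B_comm z x, H.B_comm z y]

theorem B_smul_left (H : CD c d r) (a : ℤ) (x y : I → ℤ) : BZ c d (a • x) y = a * BZ c d x y := by
  rw [H.B_comm, H.B_smul_right, H.B_comm]

theorem B_neg_left (H : CD c d r) (x y : I → ℤ) : BZ c d (-x) y = - BZ c d x y := by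
  have := H.B_smul_left (-1) x y
  simpa using this

theorem B_neg_right (H : CD c d r) (x y : I → ℤ) : BZ c d x (-y) = - BZ c d x y := by
  have := H.B_smul_right (-1) x y
  simpa using this

theorem B_sub_left (H : CD c d r) (x y z : I → ℤ) : BZ c d (x - y) z = BZ c d x z - BZ c d y z := by
  rw [sub_eq_add_neg, H.B_add_left, H.B_neg_left]; ring

theorem B_sub_right (H : CD c d r) (x y z : I → ℤ) : BZ c d x (y - z) = BZ c d x y - BZ c d x z := by
  rw [sub_eq_add_neg, H.B_add_right, H.B_neg_right]; ring

theorem B_alpha_right (H : CD c d r) (i : I) (x : I → ℤ) : BZ c d x (alphaZ i) = d i * prZ c i x := by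
  rw [H.B_comm, H.B_alpha_left]

theorem B_alpha_alpha (H : CD c d r) (i j : I) : BZ c d (alphaZ i) (alphaZ j) = d i * c i j := by
  rw [H.B_alpha_left, prZ_alpha]

theorem B_s (H : CD c d r) (i : I) (x y : I → ℤ) : BZ c d (sZ c i x) (sZ c i y) = BZ c d x y := by
  rw [sZ_eq, sZ_eq, H.B_sub_left, H.B_sub_right, H.B_sub_right, H.B_smul_left, H.B_smul_left,
    H.B_smul_right, H.B_smul_right, H.B_alpha_alpha, H.B_alpha_left, H.B_alpha_right, H.hdiag]
  ring

theorem B_act (H : CD c d r) (l : List I) (x y : I → ℤ) : BZ c d (actW c l x) (actW c l y) = BZ c d x y := by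
  induction l with
  | nil => rfl
  | cons i l ih => simp only [actW, H.B_s, ih]

/-- connectivity principle -/
theorem conn_const (H : CD c d r) {R : Type} (g : I → R) (h : ∀ i j, i ≠ j → c i j ≠ 0 → g i = g j) (i j : I) :
    g i = g j := by
  induction H.hconn i j with
  | refl => rfl
  | tail _ hb ih => rw [ih]; exact h _ _ hb.1 hb.2

/-- positive definiteness of the form -/
theorem B_pos (H : CD c d r) [Nonempty I] (x : I → ℤ) (hx : x ≠ 0) : 0 < BZ c d x x := by
  classical
  set S := H.hWfin.toFinset with hS
  let F : (I → ℤ) → (I → ℤ) → ℤ := fun x y => ∑ w ∈ S, ∑ k, w x k * w y k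
  have memS : ∀ w, w ∈ S ↔ ∃ l, w = actW c l := by
    intro w; rw [hS, Set.Finite.mem_toFinset, Set.mem_ofPred_eq, memW_iff]
  have Fadd : ∀ x y z, F x (y + z) = F x y + F x z := by
    intro x y z
    simp only [F, ← Finset.sum_add_distrib]
    refine Finset.sum_congr rfl fun w hw => ?_
    obtain ⟨l, rfl⟩ := (memS w).1 hw
    simp only [act_add, Pi.add_apply]
    exact Finset.sum_congr rfl fun k _ => by ring
  have Fsmul : ∀ (a : ℤ) x y, F x (a • y) = a * F x y := by
    intro a x y
    simp only [F, Finset.mul_sum]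
    refine Finset.sum_congr rfl fun w hw => ?_
    obtain ⟨l, rfl⟩ := (memS w).1 hw
    simp only [act_smul, Pi.smul_apply, smul_eq_mul]
    exact Finset.sum_congr rfl fun k _ => by ring
  have Fcomm : ∀ x y, F x y = F y x := by
    intro x y
    refine Finset.sum_congr rfl fun w hw => Finset.sum_congr rfl fun k _ => mul_comm _ _
  have Finv : ∀ i x y, F (sZ c i x) (sZ c i y) = F x y := by
    intro i x y
    have hm : ∀ w ∈ S, (fun z => w (sZ c i z)) ∈ S := by
      intro w hw
      obtain ⟨l, rfl⟩ := (memS w).1 hw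
      refine (memS _).2 ⟨l ++ [i], ?_⟩
      funext z; rw [act_append]; rfl
    refine Finset.sum_bij' (fun w _ => fun z => w (sZ c i z)) (fun w _ => fun z => w (sZ c i z))
      hm hm ?_ ?_ ?_
    · intro w _; funext z; simp only [H.s_s]
    · intro w _; funext z; simp only [H.s_s]
    · intro w _; rfl
  have Fpos : ∀ x, x ≠ 0 → 0 < F x x := by
    intro x hx
    have h1 : (fun z => z) ∈ S := (memS _).2 ⟨[], rfl⟩
    have h2 : 0 < ∑ k, x k * x k := by
      obtain ⟨k, hk⟩ := Function.ne_iff.1 hx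
      exact Finset.sum_pos' (fun k _ => mul_self_nonneg _) ⟨k, Finset.mem_univ _, by
        have : x k ≠ 0 := hk
        exact mul_self_pos.2 this⟩
    refine lt_of_lt_of_le h2 ?_
    exact Finset.single_le_sum (f := fun w : (I → ℤ) → (I → ℤ) => ∑ k, w x k * w x k)
      (fun w _ => Finset.sum_nonneg fun k _ => mul_self_nonneg _) h1
  have Fa : ∀ i y, 2 * F (alphaZ i) y = prZ c i y * F (alphaZ i) (alphaZ i) := by
    intro i y
    have h := Finv i (alphaZ i) y
    have e1 : sZ c i y = y + (-prZ c i y) • alphaZ i := by rw [sZ_eq]; module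
    have e2 : -alphaZ i = (-1 : ℤ) • alphaZ i := by simp
    rw [H.s_alpha, e1, Fadd, Fsmul, e2, Fcomm, Fsmul, Fcomm ((-1 : ℤ) • _), Fsmul, Fcomm y] at h
    linarith
  have hg : ∀ i j, d j * F (alphaZ i) (alphaZ i) = d i * F (alphaZ j) (alphaZ j) := by
    obtain ⟨i0⟩ := ‹Nonempty I›
    have key : ∀ i j : I, (F (alphaZ i) (alphaZ i) : ℚ) / d i = F (alphaZ j) (alphaZ j) / d j := by
      refine H.conn_const (fun i => (F (alphaZ i) (alphaZ i) : ℚ) / d i) ?_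
      intro i j _ hc
      have h1 := Fa i (alphaZ j)
      have h2 := Fa j (alphaZ i)
      rw [prZ_alpha] at h1 h2
      rw [Fcomm] at h2
      have h3 := H.hsymm i j
      have hi := H.hdpos i
      have hj := H.hdpos j
      have hi' : (d i : ℚ) ≠ 0 := by exact_mod_cast hi.ne'
      have hj' : (d j : ℚ) ≠ 0 := by exact_mod_cast hj.ne'
      rw [div_eq_div_iff hi' hj']
      norm_cast
      have : c i j * (F (alphaZ i) (alphaZ i) * d j - F (alphaZ j) (alphaZ j) * d i) = 0 := by
        linear_combination (d j) * h2 - (d j) * h1 - F (alphaZ j) (alphaZ j) * h3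
      rcases mul_eq_zero.1 this with h | h
      · exact absurd h hc
      · linarith
    intro i j
    have h := key i j
    have hi := H.hdpos i
    have hj := H.hdpos j
    have hi' : (d i : ℚ) ≠ 0 := by exact_mod_cast hi.ne'
    have hj' : (d j : ℚ) ≠ 0 := by exact_mod_cast hj.ne'
    rw [div_eq_div_iff hi' hj'] at h
    norm_cast at h
    linarith
  obtain ⟨i0⟩ := ‹Nonempty I›
  have Fsum : ∀ (s : Finset I) (y : I → ℤ), F y (∑ k ∈ s, x k • alphaZ k)
      = ∑ k ∈ s, x k * F y (alphaZ k) := by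
    intro s y
    induction s using Finset.induction_on with
    | empty =>
      have := Fsmul 0 y 0
      simpa using this
    | insert a s ha ih => rw [Finset.sum_insert ha, Finset.sum_insert ha, Fadd, Fsmul, ih]
  have h1 : d i0 * (2 * F x x) = F (alphaZ i0) (alphaZ i0) * BZ c d x x := by
    conv_lhs => rw [show F x x = F x (∑ k, x k • alphaZ k) by rw [← vec_decomp x]]
    rw [Fsum, BZ, Finset.mul_sum, Finset.mul_sum, Finset.mul_sum]
    refine Finset.sum_congr rfl fun k _ => ?_
    rw [Fcomm]
    linear_combination (d i0 * x k) * Fa k x + x k * prZ c k x * hg k i0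
  have h2 := Fpos x hx
  have h3 := Fpos (alphaZ i0) (by
    intro h
    have := congrFun h i0
    simp [alphaZ] at this)
  have h4 := H.hdpos i0
  have h5 : 0 < F (alphaZ i0) (alphaZ i0) * BZ c d x x := by rw [← h1]; positivity
  exact (pos_iff_pos_of_mul_pos h5).1 h3

end CD
end

section
variable [Fintype I] [DecidableEq I] {c : I → I → ℤ} {d : I → ℤ} {r : ℤ}

/-- real roots -/
def IsRt (c : I → I → ℤ) (β : I → ℤ) : Prop := ∃ l i, β = actW c l (alphaZ i)

theorem isRt_alpha (i : I) : IsRt c (alphaZ i) := ⟨[], i, rfl⟩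

theorem IsRt.act {β : I → ℤ} (h : IsRt c β) (l : List I) : IsRt c (actW c l β) := by
  obtain ⟨m, i, rfl⟩ := h
  exact ⟨l ++ m, i, by rw [act_append]⟩

theorem IsRt.s {β : I → ℤ} (h : IsRt c β) (i : I) : IsRt c (sZ c i β) := h.act [i]

theorem alphaZ_self (i : I) : alphaZ i i = 1 := by simp [alphaZ]
theorem alphaZ_ne {i k : I} (h : k ≠ i) : alphaZ i k = 0 := by simp [alphaZ, h]
theorem alphaZ_nonneg (i : I) : 0 ≤ alphaZ i := by
  intro k
  by_cases h : k = i
  · subst h; simp [alphaZ]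
  · simp [alphaZ, h]
theorem alphaZ_inj {i j : I} (h : alphaZ i = alphaZ j) : i = j := by
  by_contra hne
  have := congrFun h i
  rw [alphaZ_self, alphaZ_ne hne] at this
  exact one_ne_zero this
theorem alphaZ_ne_zero (i : I) : alphaZ i ≠ 0 := by
  intro h
  have := congrFun h i
  rw [alphaZ_self] at this
  exact one_ne_zero this

namespace CD

theorem neg_isRt (H : CD c d r) {β : I → ℤ} (h : IsRt c β) : IsRt c (-β) := by
  obtain ⟨m, i, rfl⟩ := h
  refine ⟨m ++ [i], i, ?_⟩
  rw [act_append, act_single, H.s_alpha, act_neg]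

theorem rt_ne_zero (H : CD c d r) {β : I → ℤ} (h : IsRt c β) : β ≠ 0 := by
  obtain ⟨m, i, rfl⟩ := h
  intro h
  have : actW c m.reverse (actW c m (alphaZ i)) = 0 := by rw [h, act_zero]
  rw [H.rev_act] at this
  exact alphaZ_ne_zero i this

theorem dvd_act (H : CD c d r) (e : ℤ) (x : I → ℤ) (hx : ∀ k, e ∣ d k * x k) (l : List I) :
    ∀ k, e ∣ d k * actW c l x k := by
  induction l with
  | nil => exact hx
  | cons i l ih =>
    intro k
    have hp : e ∣ d i * prZ c i (actW c l x) := by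
      rw [prZ, Finset.mul_sum]
      refine Finset.dvd_sum fun j _ => ?_
      have : d i * (c i j * actW c l x j) = (d j * actW c l x j) * c j i := by
        linear_combination (actW c l x j) * H.hsymm i j
      rw [this]
      exact Dvd.dvd.mul_right (ih j) _
    simp only [actW, sZ_eq, Pi.sub_apply, Pi.smul_apply, smul_eq_mul]
    rw [mul_sub]
    refine dvd_sub (ih k) ?_
    by_cases h : k = i
    · subst h; rw [alphaZ_self, mul_one]; exact hp
    · rw [alphaZ_ne h]; simp

theorem dvd_alpha (H : CD c d r) (i k : I) : d i ∣ d k * alphaZ i k := by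
  by_cases h : k = i
  · subst h; simp [alphaZ_self]
  · simp [alphaZ_ne h]

theorem B_even (H : CD c d r) (e : ℤ) (x : I → ℤ) (hx : ∀ k, e ∣ d k * x k) :
    2 * e ∣ BZ c d x x := by
  have key : ∀ s : Finset I, 2 * e ∣ BZ c d (∑ k ∈ s, x k • alphaZ k) (∑ k ∈ s, x k • alphaZ k) := by
    intro s
    induction s using Finset.induction_on with
    | empty => simp [BZ]
    | insert a s ha ih =>
      rw [Finset.sum_insert ha]
      set y := ∑ k ∈ s, x k • alphaZ k
      have : BZ c d (x a • alphaZ a + y) (x a • alphaZ a + y)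
          = BZ c d y y + 2 * ((d a * x a) * (x a + prZ c a y)) := by
        rw [H.B_add_left, H.B_add_right, H.B_add_right, H.B_smul_left, H.B_smul_right,
          H.B_alpha_alpha, H.B_smul_left, H.B_smul_right, H.B_alpha_left, H.B_alpha_right, H.hdiag]
        ring
      rw [this]
      exact dvd_add ih (mul_dvd_mul_left 2 (Dvd.dvd.mul_right (hx a) _))
  have := key Finset.univ
  rwa [← vec_decomp x] at this

theorem rt_sign [Nonempty I] (H : CD c d r) {β : I → ℤ} (h : IsRt c β) : 0 ≤ β ∨ β ≤ 0 := by
  obtain ⟨l, i, rfl⟩ := h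
  set β := actW c l (alphaZ i) with hβ
  have hdv : ∀ k, d i ∣ d k * β k := H.dvd_act (d i) _ (H.dvd_alpha i) l
  have hn : BZ c d β β = 2 * d i := by
    rw [hβ, H.B_act, H.B_alpha_alpha, H.hdiag]; ring
  by_contra hcon
  push Not at hcon
  set p : I → ℤ := fun k => max (β k) 0 with hp
  set m : I → ℤ := fun k => max (-β k) 0 with hm
  have hpm : β = p - m := by
    funext k
    simp only [hp, hm, Pi.sub_apply]
    rcases le_total (β k) 0 with h | h
    · rw [max_eq_right h, max_eq_left (by linarith)]; ring
    · rw [max_eq_left h, max_eq_right (by linarith)]; ring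
  have hp0 : p ≠ 0 := by
    intro h
    apply hcon.2
    intro k
    have := congrFun h k
    simp only [hp, Pi.zero_apply] at this
    exact max_eq_right_iff.1 this
  have hm0 : m ≠ 0 := by
    intro h
    apply hcon.1
    intro k
    have := congrFun h k
    simp only [hm, Pi.zero_apply] at this
    have h2 := max_eq_right_iff.1 this
    simp only [Pi.zero_apply]
    linarith
  have hB : BZ c d p m ≤ 0 := by
    simp only [BZ, prZ, Finset.mul_sum]
    refine Finset.sum_nonpos fun a _ => Finset.sum_nonpos fun b _ => ?_
    have h1 : 0 ≤ p a := le_max_right _ _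
    have h2 : 0 ≤ m b := le_max_right _ _
    by_cases hab : a = b
    · subst hab
      have : p a * m a = 0 := by
        simp only [hp, hm]
        rcases le_total (β a) 0 with h | h
        · rw [max_eq_right h]; ring
        · rw [max_eq_right (a := -β a) (by linarith)]; ring
      have e : p a * (d a * (c a a * m a)) = (p a * m a) * (d a * c a a) := by ring
      rw [e, this, zero_mul]
    · have h3 := H.hoff a b hab
      have h4 := H.hdpos a
      have : 0 ≤ p a * (d a * (-c a b * m b)) := by
        have : 0 ≤ -c a b := by linarith
        positivity
      linarith
  have hdp : 2 * d i ∣ BZ c d p p := H.B_even _ _ fun k => by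
    rcases le_total (β k) 0 with h | h
    · simp only [hp, max_eq_right h]; simp
    · simp only [hp, max_eq_left h]; exact hdv k
  have hdm : 2 * d i ∣ BZ c d m m := H.B_even _ _ fun k => by
    rcases le_total (β k) 0 with h | h
    · simp only [hm, max_eq_left (show (0:ℤ) ≤ -β k by linarith)]
      rw [mul_neg]; exact (hdv k).neg_right
    · simp only [hm, max_eq_right (show -β k ≤ (0:ℤ) by linarith)]; simp
  have h1 := Int.le_of_dvd (H.B_pos p hp0) hdp
  have h2 := Int.le_of_dvd (H.B_pos m hm0) hdm
  rw [hpm, H.B_sub_left, H.B_sub_right, H.B_sub_right, H.B_comm m p] at hn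
  have := H.hdpos i
  linarith

theorem not_nonneg_iff [Nonempty I] (H : CD c d r) {β : I → ℤ} (h : IsRt c β) :
    ¬ 0 ≤ β ↔ β ≤ 0 := by
  constructor
  · intro h1; exact (H.rt_sign h).resolve_left h1
  · intro h1 h2; exact H.rt_ne_zero h (le_antisymm h1 h2)

/-- a positive root other than `α_i` remains positive under `s_i` -/
theorem s_pos [Nonempty I] (H : CD c d r) {β : I → ℤ} (h : IsRt c β) (h0 : 0 ≤ β) (i : I)
    (hne : β ≠ alphaZ i) : 0 ≤ sZ c i β := by
  rcases H.rt_sign (h.s i) with h1 | h1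
  · exact h1
  exfalso
  have hk : ∀ k, k ≠ i → β k = 0 := by
    intro k hk
    have := h1 k
    rw [sZ_eq] at this
    simp only [Pi.sub_apply, Pi.smul_apply, alphaZ_ne hk, smul_zero, sub_zero, Pi.zero_apply] at this
    exact le_antisymm this (h0 k)
  have hβ : β = β i • alphaZ i := by
    funext k
    by_cases e : k = i
    · subst e; simp [alphaZ_self]
    · simp [alphaZ_ne e, hk k e]
  obtain ⟨l, j, hl⟩ := h
  have h2 : alphaZ j = β i • actW c l.reverse (alphaZ i) := by
    rw [← act_smul, ← hβ, hl, H.rev_act]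
  have h3 := congrFun h2 j
  rw [alphaZ_self, Pi.smul_apply, smul_eq_mul] at h3
  have h4 : β i = 1 := Int.eq_one_of_mul_eq_one_right (h0 i) h3.symm
  rw [h4, one_smul] at hβ
  exact hne hβ

theorem reflection_conj (H : CD c d r) {l : List I} {k j : I}
    (h : actW c l (alphaZ k) = alphaZ j) (x : I → ℤ) :
    actW c l (sZ c k (actW c l.reverse x)) = sZ c j x := by
  have hd : d k = d j := by
    have := H.B_act l (alphaZ k) (alphaZ k)
    rw [h, H.B_alpha_alpha, H.B_alpha_alpha, H.hdiag, H.hdiag] at this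
    linarith
  have h2 := H.B_act l (alphaZ k) (actW c l.reverse x)
  rw [h, H.act_rev, H.B_alpha_left, H.B_alpha_left, hd] at h2
  have h3 := mul_left_cancel₀ (H.hdpos j).ne' h2
  rw [sZ_eq, act_sub, H.act_rev, act_smul, h, sZ_eq, h3]

/-- exchange -/
theorem exchange [Nonempty I] (H : CD c d r) (l m : List I) (k : I) (h0 : 0 ≤ actW c m (alphaZ k))
    (h1 : ¬ 0 ≤ actW c l.reverse (actW c m (alphaZ k))) :
    ∃ l', l'.length + 1 = l.length ∧
      ∀ x, actW c l' x = actW c m (sZ c k (actW c m.reverse (actW c l x))) := by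
  induction l generalizing m with
  | nil => exact absurd h0 h1
  | cons j l ih =>
    by_cases hj : actW c m (alphaZ k) = alphaZ j
    · refine ⟨l, by simp, fun x => ?_⟩
      rw [H.reflection_conj hj]
      simp only [actW, H.s_s]
    · have h2 := H.s_pos ⟨m, k, rfl⟩ h0 j hj
      obtain ⟨l', hl, hx⟩ := ih (j :: m) h2 (by
        intro h3
        apply h1
        rw [List.reverse_cons, act_append]
        exact h3)
      refine ⟨j :: l', by simp [hl], fun x => ?_⟩
      simp only [actW, hx, List.reverse_cons, act_append, H.s_s]

/-- finite set of positive roots -/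
theorem rt_finite (H : CD c d r) : {β : I → ℤ | IsRt c β}.Finite := by
  have : {β : I → ℤ | IsRt c β} ⊆ ⋃ i : I, (fun w : (I → ℤ) → (I → ℤ) => w (alphaZ i)) ''
      {w | memW c w} := by
    rintro β ⟨l, i, rfl⟩
    exact Set.mem_iUnion.2 ⟨i, actW c l, (memW_iff _).2 ⟨l, rfl⟩, rfl⟩
  exact Set.Finite.subset (Set.finite_iUnion fun i => H.hWfin.image _) this

/-- the finset of all roots -/
def Ph (H : CD c d r) : Finset (I → ℤ) := H.rt_finite.toFinset

theorem mem_Ph (H : CD c d r) {β : I → ℤ} : β ∈ H.Ph ↔ IsRt c β := by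
  simp [Ph]

open Classical in
/-- positive roots -/
def Pp (H : CD c d r) : Finset (I → ℤ) := H.Ph.filter (fun β => 0 ≤ β)

theorem mem_Pp (H : CD c d r) {β : I → ℤ} : β ∈ H.Pp ↔ IsRt c β ∧ 0 ≤ β := by
  simp [Pp, mem_Ph]

open Classical in
/-- weighted inversion number of the inverse of the element given by a word -/
def nf (H : CD c d r) (f : (I → ℤ) → ℤ) (l : List I) : ℤ :=
  ∑ β ∈ H.Pp, if 0 ≤ actW c l.reverse β then 0 else f β

theorem sum_split (H : CD c d r) (i : I) (g : (I → ℤ) → ℤ) :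
    ∑ β ∈ H.Pp, g β = g (alphaZ i) + ∑ β ∈ H.Pp.erase (alphaZ i), g β :=
  (Finset.add_sum_erase _ _ (H.mem_Pp.2 ⟨isRt_alpha i, alphaZ_nonneg i⟩)).symm

theorem sum_erase_s [Nonempty I] (H : CD c d r) {M : Type} [AddCommMonoid M] (i : I)
    (g : (I → ℤ) → M) :
    ∑ β ∈ H.Pp.erase (alphaZ i), g (sZ c i β) = ∑ β ∈ H.Pp.erase (alphaZ i), g β := by
  have hm : ∀ β ∈ H.Pp.erase (alphaZ i), sZ c i β ∈ H.Pp.erase (alphaZ i) := by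
    intro β hβ
    rw [Finset.mem_erase, H.mem_Pp] at hβ ⊢
    refine ⟨?_, hβ.2.1.s i, H.s_pos hβ.2.1 hβ.2.2 i hβ.1⟩
    intro h
    have h2 : β = - alphaZ i := by rw [← H.s_s i β, h, H.s_alpha]
    have h3 := hβ.2.2 i
    rw [h2] at h3
    simp [alphaZ_self] at h3
  exact Finset.sum_bij' (fun β _ => sZ c i β) (fun β _ => sZ c i β) hm hm
    (fun β _ => H.s_s i β) (fun β _ => H.s_s i β) (fun _ _ => rfl)

theorem nf_nil [Nonempty I] (H : CD c d r) (f : (I → ℤ) → ℤ) : H.nf f [] = 0 := by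
  refine Finset.sum_eq_zero fun β hβ => if_pos ?_
  exact (H.mem_Pp.1 hβ).2

open Classical in
theorem nf_cons [Nonempty I] (H : CD c d r) (f : (I → ℤ) → ℤ)
    (hf : ∀ i β, f (sZ c i β) = f β) (i : I) (l : List I) :
    H.nf f (i :: l) = H.nf f l + if 0 ≤ actW c l.reverse (alphaZ i) then f (alphaZ i)
      else - f (alphaZ i) := by
  unfold nf
  rw [H.sum_split i, H.sum_split i]
  have e : ∀ x, actW c (i :: l).reverse x = actW c l.reverse (sZ c i x) := by
    intro x; rw [List.reverse_cons, act_append]; rfl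
  have h1 := H.sum_erase_s i (fun β => if 0 ≤ actW c l.reverse β then 0 else f β)
  simp only [hf] at h1
  simp only [e]
  rw [h1, H.s_alpha, act_neg]
  have hr : IsRt c (actW c l.reverse (alphaZ i)) := (isRt_alpha i).act _
  have h2 : (0 ≤ -actW c l.reverse (alphaZ i)) ↔ ¬ (0 ≤ actW c l.reverse (alphaZ i)) := by
    rw [H.not_nonneg_iff hr]; exact neg_nonneg
  by_cases h : 0 ≤ actW c l.reverse (alphaZ i)
  · rw [if_neg (fun h' => h2.1 h' h), if_pos h, if_pos h]; ring
  · rw [if_pos (h2.2 h), if_neg h, if_neg h]; ring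

theorem nf_congr (H : CD c d r) (f : (I → ℤ) → ℤ) {l m : List I} (h : actW c l = actW c m) :
    H.nf f l = H.nf f m := by
  unfold nf; rw [H.rev_congr h]

/-- length -/
def nn (H : CD c d r) (l : List I) : ℤ := H.nf (fun _ => 1) l

/-- reduced words -/
def Red (H : CD c d r) (l : List I) : Prop := H.nn l = l.length

theorem nn_pos [Nonempty I] (H : CD c d r) {i : I} {l : List I}
    (h : 0 ≤ actW c l.reverse (alphaZ i)) : H.nn (i :: l) = H.nn l + 1 := by
  unfold nn; rw [H.nf_cons _ (fun _ _ => rfl), if_pos h]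

theorem nn_neg [Nonempty I] (H : CD c d r) {i : I} {l : List I}
    (h : ¬ 0 ≤ actW c l.reverse (alphaZ i)) : H.nn (i :: l) = H.nn l - 1 := by
  unfold nn; rw [H.nf_cons _ (fun _ _ => rfl), if_neg h]; ring

theorem nn_le [Nonempty I] (H : CD c d r) (l : List I) : H.nn l ≤ l.length := by
  induction l with
  | nil => simp [nn, H.nf_nil]
  | cons i l ih =>
    push_cast [List.length_cons]
    by_cases h : 0 ≤ actW c l.reverse (alphaZ i)
    · rw [H.nn_pos h]; linarith
    · rw [H.nn_neg h]; linarith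

theorem red_cons [Nonempty I] (H : CD c d r) (i : I) (l : List I) :
    H.Red (i :: l) ↔ H.Red l ∧ 0 ≤ actW c l.reverse (alphaZ i) := by
  unfold Red
  push_cast [List.length_cons]
  have := H.nn_le l
  by_cases h : 0 ≤ actW c l.reverse (alphaZ i)
  · rw [H.nn_pos h]; simp [h]
  · rw [H.nn_neg h]; simp only [h, and_false, iff_false]; intro h'; linarith

theorem red_nf [Nonempty I] (H : CD c d r) (f : (I → ℤ) → ℤ)
    (hf : ∀ i β, f (sZ c i β) = f β) (l : List I) (hl : H.Red l) :
    H.nf f l = (l.map fun i => f (alphaZ i)).sum := by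
  induction l with
  | nil => simp [H.nf_nil]
  | cons i l ih =>
    rw [H.red_cons] at hl
    rw [H.nf_cons f hf, if_pos hl.2, ih hl.1, List.map_cons, List.sum_cons, add_comm]

theorem exists_red [Nonempty I] (H : CD c d r) : ∀ (n : ℕ) (l : List I), l.length ≤ n →
    ∃ l', H.Red l' ∧ actW c l' = actW c l ∧ l'.length ≤ n := by
  intro n
  induction n with
  | zero =>
    intro l hl
    have : l = [] := by simpa using hl
    subst this
    exact ⟨[], by simp [Red, nn, H.nf_nil], rfl, le_rfl⟩
  | succ n ih =>
    intro l hl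
    cases l with
    | nil => exact ⟨[], by simp [Red, nn, H.nf_nil], rfl, by simp⟩
    | cons i l =>
      obtain ⟨l1, hr, ha, hlen⟩ := ih l (by simpa using hl)
      by_cases h : 0 ≤ actW c l1.reverse (alphaZ i)
      · refine ⟨i :: l1, (H.red_cons i l1).2 ⟨hr, h⟩, ?_, by simpa using hlen⟩
        funext x; simp only [actW, ha]
      · obtain ⟨l2, h2, h3⟩ := H.exchange l1 [] i (alphaZ_nonneg i) h
        obtain ⟨l3, h4, h5, h6⟩ := ih l2 (by omega)
        refine ⟨l3, h4, ?_, by omega⟩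
        rw [h5]
        funext x
        rw [h3]
        simp only [actW, List.reverse_nil, ha]

end CD
end

/-- alternating words -/
def altW : ℕ → I → I → List I
  | 0, _, _ => []
  | n + 1, a, b => a :: altW n b a

/-- order of the product of two simple reflections -/
def mW (c : I → I → ℤ) (i j : I) : ℕ :=
  if c i j * c j i = 0 then 2 else if c i j * c j i = 1 then 3 else
  if c i j * c j i = 2 then 4 else 6

section
variable [Fintype I] [DecidableEq I] {c : I → I → ℤ} {d : I → ℤ} {r : ℤ}

/-- rank two facts -/
structure RK (c : I → I → ℤ) (m : ℕ) (i j : I) : Prop where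
  eq : actW c (altW m i j) = actW c (altW m j i)
  pos : ∀ k, k < m → ∃ p q : ℤ, 0 ≤ p ∧ 0 ≤ q ∧
    actW c (altW k j i).reverse (alphaZ i) = p • alphaZ i + q • alphaZ j
  neg : actW c (altW m i j) (alphaZ i) = - alphaZ i ∨ actW c (altW m i j) (alphaZ i) = - alphaZ j
  mpos : 0 < m

theorem alt_len (n : ℕ) (a b : I) : (altW n a b).length = n := by
  induction n generalizing a b with
  | zero => rfl
  | succ n ih => simp [altW, ih]

namespace CD

theorem step_i (H : CD c d r) (i j : I) (x : I → ℤ) (a b : ℤ) :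
    sZ c i (x - a • alphaZ i - b • alphaZ j)
      = x - (prZ c i x - a - c i j * b) • alphaZ i - b • alphaZ j := by
  rw [sZ_eq, prZ_sub, prZ_sub, prZ_smul, prZ_smul, prZ_alpha, prZ_alpha, H.hdiag]
  module

theorem step_j (H : CD c d r) (i j : I) (x : I → ℤ) (a b : ℤ) :
    sZ c j (x - a • alphaZ i - b • alphaZ j)
      = x - a • alphaZ i - (prZ c j x - b - c j i * a) • alphaZ j := by
  rw [sZ_eq, prZ_sub, prZ_sub, prZ_smul, prZ_smul, prZ_alpha, prZ_alpha, H.hdiag]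
  module

theorem pstep_i (H : CD c d r) (i j : I) (a b : ℤ) :
    sZ c i (a • alphaZ i + b • alphaZ j) = (- a - c i j * b) • alphaZ i + b • alphaZ j := by
  rw [sZ_eq, prZ_add, prZ_smul, prZ_smul, prZ_alpha, prZ_alpha, H.hdiag]
  module

theorem pstep_j (H : CD c d r) (i j : I) (a b : ℤ) :
    sZ c j (a • alphaZ i + b • alphaZ j) = a • alphaZ i + (- b - c j i * a) • alphaZ j := by
  rw [sZ_eq, prZ_add, prZ_smul, prZ_smul, prZ_alpha, prZ_alpha, H.hdiag]
  module

/-- the possible rank two subsystems -/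
theorem rank_two [Nonempty I] (H : CD c d r) {i j : I} (hij : i ≠ j) :
    (c i j = 0 ∧ c j i = 0) ∨ (c i j = -1 ∧ c j i = -1 ∧ d i = d j) ∨
    (c i j = -1 ∧ c j i = -2 ∧ d i = 2 ∧ d j = 1) ∨ (c i j = -2 ∧ c j i = -1 ∧ d i = 1 ∧ d j = 2) ∨
    (c i j = -1 ∧ c j i = -3 ∧ d i = 3 ∧ d j = 1) ∨
    (c i j = -3 ∧ c j i = -1 ∧ d i = 1 ∧ d j = 3) := by
  have hs := H.hsymm i j
  have hi := H.hdpos i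
  have hj := H.hdpos j
  by_cases h0 : c i j = 0
  · left
    refine ⟨h0, ?_⟩
    rw [h0, mul_zero] at hs
    rcases mul_eq_zero.1 hs.symm with h | h
    · exact absurd h hj.ne'
    · exact h
  right
  have h1 : d i * c i j = -(max (d i) (d j)) := H.hbmax i j hij h0
  have hBB : ∀ a b : ℤ, a ≠ 0 → 0 < 2 * d i * a ^ 2 + 2 * d j * b ^ 2 + 2 * (d i * c i j) * (a * b) := by
    intro a b ha
    have := H.B_pos (a • alphaZ i + b • alphaZ j) (by
      intro h
      have := congrFun h i
      simp [alphaZ_self, alphaZ_ne hij] at this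
      exact ha this)
    rw [H.B_add_left, H.B_add_right, H.B_add_right, H.B_smul_left, H.B_smul_left, H.B_smul_left,
      H.B_smul_left,
      H.B_smul_right, H.B_smul_right, H.B_smul_right, H.B_smul_right, H.B_alpha_alpha, H.B_alpha_alpha,
      H.B_alpha_alpha, H.B_alpha_alpha, ← H.hsymm i j, H.hdiag, H.hdiag] at this
    linarith
  have hri := H.hrmax i
  have hrj := H.hrmax j
  rcases H.honer i with hdi | hdi <;> rcases H.honer j with hdj | hdj
  · rw [hdi, hdj] at h1
    rw [hdi, hdj] at hs
    left
    refine ⟨by simpa using h1, ?_, by rw [hdi, hdj]⟩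
    have : c i j = -1 := by simpa using h1
    linarith
  · have hB := hBB 2 1 (by norm_num)
    rw [h1, hdi, hdj, max_eq_right (by linarith)] at hB
    rw [hdi, hdj, max_eq_right (by linarith), one_mul] at h1
    rw [hdi, hdj, h1] at hs
    have hrr : r < 4 := by linarith
    have hr0 : 0 < r := by linarith
    have hc : c j i = -1 := mul_left_cancel₀ hr0.ne' (by linarith)
    have : r = 1 ∨ r = 2 ∨ r = 3 := by omega
    rcases this with rfl | rfl | rfl
    · left; exact ⟨h1, hc, by linarith⟩
    · right; right; left; exact ⟨h1, hc, hdi, hdj⟩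
    · right; right; right; right; exact ⟨h1, hc, hdi, hdj⟩
  · have hB := hBB 1 2 (by norm_num)
    rw [h1, hdi, hdj, max_eq_left (by linarith)] at hB
    rw [hdi, hdj, max_eq_left (by linarith)] at h1
    rw [hdi, hdj] at hs
    have hrr : r < 4 := by linarith
    have hr0 : 0 < r := by linarith
    have hc : c i j = -1 := mul_left_cancel₀ hr0.ne' (by linarith)
    have hc' : c j i = -r := by rw [hc] at hs; linarith
    have : r = 1 ∨ r = 2 ∨ r = 3 := by omega
    rcases this with rfl | rfl | rfl
    · left; exact ⟨hc, hc', by linarith⟩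
    · right; left; exact ⟨hc, hc', hdi, hdj⟩
    · right; right; right; left; exact ⟨hc, hc', hdi, hdj⟩
  · have hr0 : 0 < r := by linarith
    rw [hdi, hdj, max_self] at h1
    rw [hdi, hdj] at hs
    left
    have : c i j = -1 := mul_left_cancel₀ hr0.ne' (by linarith)
    refine ⟨this, ?_, by linarith⟩
    rw [this] at hs
    exact mul_left_cancel₀ hr0.ne' hs.symm

theorem rk_aux (H : CD c d r) {i j : I} {m : ℕ} 
    (h : (m = 2 ∧ c i j = 0 ∧ c j i = 0) ∨ (m = 3 ∧ c i j = -1 ∧ c j i = -1) ∨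
      (m = 4 ∧ c i j = -1 ∧ c j i = -2) ∨ (m = 4 ∧ c i j = -2 ∧ c j i = -1) ∨ 
      (m = 6 ∧ c i j = -1 ∧ c j i = -3) ∨ (m = 6 ∧ c i j = -3 ∧ c j i = -1)) : RK c m i j := by
  have e0 : ∀ x : I → ℤ, x = x - (0 : ℤ) • alphaZ i - (0 : ℤ) • alphaZ j := by intro x; module
  have e1 : alphaZ i = (1 : ℤ) • alphaZ i + (0 : ℤ) • alphaZ j := by module
  rcases h with ⟨rfl, h1, h2⟩ | ⟨rfl, h1, h2⟩ | ⟨rfl, h1, h2⟩ | ⟨rfl, h1, h2⟩ | ⟨rfl, h1, h2⟩ |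
    ⟨rfl, h1, h2⟩ <;>
  refine ⟨?_, ?_, ?_, by norm_num⟩
  all_goals first
    | (funext x
       conv_lhs => rw [e0 x]
       conv_rhs => rw [e0 x]
       simp only [altW, actW, H.step_i, H.step_j, h1, h2]
       module)
    | (intro k hk
       rw [congrArg (actW c (altW k j i).reverse) e1]
       interval_cases k <;>
       simp only [altW, actW, List.reverse_cons, List.reverse_nil, List.nil_append,
         List.cons_append, H.pstep_i, H.pstep_j, h1, h2] <;>
       exact ⟨_, _, by norm_num, by norm_num, rfl⟩)
    | (left
       rw [e1]
       simp only [altW, actW, H.pstep_i, H.pstep_j, h1, h2]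
       module)
    | (right
       rw [e1]
       simp only [altW, actW, H.pstep_i, H.pstep_j, h1, h2]
       module)

theorem rk [Nonempty I] (H : CD c d r) {i j : I} (hij : i ≠ j) : RK c (mW c i j) i j := by
  apply H.rk_aux
  rcases H.rank_two hij with ⟨h1, h2⟩ | ⟨h1, h2, _⟩ | ⟨h1, h2, _⟩ | ⟨h1, h2, _⟩ | ⟨h1, h2, _⟩ |
    ⟨h1, h2, _⟩ <;> simp [mW, h1, h2]

theorem mW_comm (H : CD c d r) (i j : I) : mW c i j = mW c j i := by
  unfold mW; rw [mul_comm]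

/-- an alternating word on top of a reduced word is reduced -/
theorem alt_red [Nonempty I] (H : CD c d r) {i j : I} {m : ℕ} (h1 : RK c m i j) (h2 : RK c m j i)
    (x : List I) (hx : H.Red x) (hi : 0 ≤ actW c x.reverse (alphaZ i))
    (hj : 0 ≤ actW c x.reverse (alphaZ j)) : ∀ k ≤ m, H.Red (altW k i j ++ x) ∧ H.Red (altW k j i ++ x) := by
  have hcomb : ∀ p q : ℤ, 0 ≤ p → 0 ≤ q → ∀ a b : I, 0 ≤ actW c x.reverse (alphaZ a) →
      0 ≤ actW c x.reverse (alphaZ b) → 0 ≤ actW c x.reverse (p • alphaZ a + q • alphaZ b) := by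
    intro p q hp hq a b ha hb
    rw [act_add, act_smul, act_smul]
    exact add_nonneg (smul_nonneg hp ha) (smul_nonneg hq hb)
  intro k
  induction k with
  | zero => intro _; exact ⟨hx, hx⟩
  | succ k ih =>
    intro hk
    obtain ⟨g1, g2⟩ := ih (by omega)
    refine ⟨(H.red_cons _ _).2 ⟨g2, ?_⟩, (H.red_cons _ _).2 ⟨g1, ?_⟩⟩
    · change 0 ≤ actW c (altW k j i ++ x).reverse _
      rw [List.reverse_append, act_append]
      obtain ⟨p, q, hp, hq, e⟩ := h1.pos k (by omega)
      rw [e]; exact hcomb p q hp hq _ _ hi hj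
    · change 0 ≤ actW c (altW k i j ++ x).reverse _
      rw [List.reverse_append, act_append]
      obtain ⟨p, q, hp, hq, e⟩ := h2.pos k (by omega)
      rw [e]; exact hcomb p q hp hq _ _ hj hi

/-- Matsumoto's theorem -/
theorem matsumoto [Nonempty I] (H : CD c d r) {M : Type} [Monoid M] (τ : I → M)
    (hτ : ∀ i j, i ≠ j → ((altW (mW c i j) i j).map τ).prod = ((altW (mW c i j) j i).map τ).prod) :
    ∀ (n : ℕ) (l l' : List I), l.length = n → H.Red l → H.Red l' → actW c l = actW c l' →
      (l.map τ).prod = (l'.map τ).prod := by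
  have hlen : ∀ l l' : List I, H.Red l → H.Red l' → actW c l = actW c l' → l.length = l'.length := by
    intro l l' h1 h2 h3
    have := H.nf_congr (fun _ => 1) h3
    unfold Red nn at h1 h2
    rw [h1, h2] at this
    exact_mod_cast this
  intro n
  induction n with
  | zero =>
    intro l l' hl h1 h2 h3
    have h4 := hlen l l' h1 h2 h3
    have e1 : l = [] := List.length_eq_zero_iff.1 hl
    have e2 : l' = [] := List.length_eq_zero_iff.1 (by omega)
    rw [e1, e2]
  | succ n ih =>
    intro l l' hl h1 h2 h3
    have h4 := hlen l l' h1 h2 h3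
    obtain ⟨i, u, rfl⟩ := List.exists_cons_of_length_eq_add_one hl
    obtain ⟨j, u', rfl⟩ := List.exists_cons_of_length_eq_add_one (h4 ▸ hl)
    have cancel : ∀ (a : I) (y z : List I), actW c (a :: y) = actW c (a :: z) →
        actW c y = actW c z := by
      intro a y z h
      funext x
      have := congrArg (sZ c a) (congrFun h x)
      simpa only [actW, H.s_s] using this
    have hu : u.length = n := by simpa using hl
    have hu' : u'.length = n := by
      simp only [List.length_cons] at h4 hl; omega
    have r1 := (H.red_cons i u).1 h1
    have r2 := (H.red_cons j u').1 h2
    by_cases hij : i = j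
    · subst hij
      rw [List.map_cons, List.map_cons, List.prod_cons, List.prod_cons,
        ih u u' hu r1.1 r2.1 (cancel i _ _ h3)]
    set m := mW c i j with hm
    have k1 : RK c m i j := H.rk hij
    have k2 : RK c m j i := by rw [hm, H.mW_comm]; exact H.rk (Ne.symm hij)
    set l := i :: u with hldef
    obtain ⟨x, hxr, hxa, -⟩ := H.exists_red _ ((altW m i j).reverse ++ l) le_rfl
    -- inverse of x
    have hxrev : ∀ y, actW c x.reverse y = actW c l.reverse (actW c (altW m i j) y) := by
      intro y
      rw [H.rev_congr hxa, List.reverse_append, act_append, List.reverse_reverse]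
    have ni : actW c l.reverse (alphaZ i) ≤ 0 := by
      rw [hldef, List.reverse_cons, act_append, act_single, H.s_alpha, act_neg]
      exact neg_nonpos.2 r1.2
    have nj : actW c l.reverse (alphaZ j) ≤ 0 := by
      rw [H.rev_congr h3, List.reverse_cons, act_append, act_single, H.s_alpha, act_neg]
      exact neg_nonpos.2 r2.2
    have pi : 0 ≤ actW c x.reverse (alphaZ i) := by
      rw [hxrev]
      rcases k1.neg with h | h <;> rw [h, act_neg]
      · exact neg_nonneg.2 ni
      · exact neg_nonneg.2 nj
    have pj : 0 ≤ actW c x.reverse (alphaZ j) := by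
      rw [hxrev, k1.eq]
      rcases k2.neg with h | h <;> rw [h, act_neg]
      · exact neg_nonneg.2 nj
      · exact neg_nonneg.2 ni
    obtain ⟨g1, g2⟩ := H.alt_red k1 k2 x hxr pi pj m le_rfl
    have a1 : actW c (altW m i j ++ x) = actW c l := by
      funext y
      rw [act_append, hxa, act_append, H.act_rev]
    have a2 : actW c (altW m j i ++ x) = actW c (j :: u') := by
      rw [← h3, ← a1]
      funext y
      rw [act_append, act_append, k1.eq]
    obtain ⟨m', hm'⟩ : ∃ m', m = m' + 1 := ⟨m - 1, by have := k1.mpos; omega⟩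
    have t1 : (l.map τ).prod = ((altW m i j ++ x).map τ).prod := by
      rw [hm'] at g1 a1 ⊢
      simp only [altW, List.cons_append] at g1 a1 ⊢
      rw [hldef, List.map_cons, List.map_cons, List.prod_cons, List.prod_cons,
        ih u _ hu r1.1 ((H.red_cons _ _).1 g1).1 (cancel i _ _ a1.symm)]
    have t2 : ((j :: u').map τ).prod = ((altW m j i ++ x).map τ).prod := by
      rw [hm'] at g2 a2 ⊢
      simp only [altW, List.cons_append] at g2 a2 ⊢
      rw [List.map_cons, List.map_cons, List.prod_cons, List.prod_cons,
        ih u' _ hu' r2.1 ((H.red_cons _ _).1 g2).1 (cancel j _ _ a2.symm)]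
    rw [t1, t2, List.map_append, List.map_append, List.prod_append, List.prod_append, hm, hτ i j hij]

end CD
end

section
variable [Fintype I] [DecidableEq I] {c : I → I → ℤ} {d : I → ℤ} {r : ℤ}

namespace CD

theorem sum_Ph_s (H : CD c d r) {M : Type} [AddCommMonoid M] (i : I) (g : (I → ℤ) → M) :
    ∑ β ∈ H.Ph, g (sZ c i β) = ∑ β ∈ H.Ph, g β := by
  have hm : ∀ β ∈ H.Ph, sZ c i β ∈ H.Ph := by
    intro β hβ
    rw [H.mem_Ph] at hβ ⊢
    exact hβ.s i
  exact Finset.sum_bij' (fun β _ => sZ c i β) (fun β _ => sZ c i β) hm hm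
    (fun β _ => H.s_s i β) (fun β _ => H.s_s i β) (fun _ _ => rfl)

theorem sum_Ph_even [Nonempty I] (H : CD c d r) (g : (I → ℤ) → ℤ) (hg : ∀ β, g (-β) = g β) :
    ∑ β ∈ H.Ph, g β = 2 * ∑ β ∈ H.Pp, g β := by
  classical
  rw [← Finset.sum_filter_add_sum_filter_not H.Ph (fun β => 0 ≤ β)]
  have h1 : ∑ β ∈ H.Ph with ¬ 0 ≤ β, g β = ∑ β ∈ H.Pp, g β := by
    refine Finset.sum_bij' (fun β _ => -β) (fun β _ => -β) ?_ ?_ ?_ ?_ ?_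
    · intro β hβ
      rw [Finset.mem_filter, H.mem_Ph] at hβ
      exact H.mem_Pp.2 ⟨H.neg_isRt hβ.1, neg_nonneg.2 ((H.not_nonneg_iff hβ.1).1 hβ.2)⟩
    · intro β hβ
      rw [H.mem_Pp] at hβ
      rw [Finset.mem_filter, H.mem_Ph]
      refine ⟨H.neg_isRt hβ.1, ?_⟩
      rw [H.not_nonneg_iff (H.neg_isRt hβ.1)]
      exact neg_nonpos.2 hβ.2
    · intro β _; exact neg_neg β
    · intro β _; exact neg_neg β
    · intro β _; exact (hg β).symm
  have h2 : ∑ β ∈ H.Ph with 0 ≤ β, g β = ∑ β ∈ H.Pp, g β := by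
    refine Finset.sum_congr ?_ fun _ _ => rfl
    ext β; rw [Finset.mem_filter, H.mem_Ph, H.mem_Pp]
  rw [h1, h2]; ring

theorem B_decomp (H : CD c d r) (x y : I → ℤ) : BZ c d x y = ∑ k, y k * BZ c d x (alphaZ k) := by
  rw [H.B_comm, BZ]
  exact Finset.sum_congr rfl fun k _ => by rw [H.B_alpha_right]

theorem B_nonneg_of (H : CD c d r) {x y : I → ℤ} (hx : 0 ≤ x) (hy : ∀ k, 0 ≤ prZ c k y) :
    0 ≤ BZ c d x y := by
  refine Finset.sum_nonneg fun i _ => ?_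
  exact mul_nonneg (hx i) (mul_nonneg (H.hdpos i).le (hy i))

/-- highest root properties -/
structure Hi (H : CD c d r) (θ : I → ℤ) : Prop where
  rt : IsRt c θ
  max : ∀ β, IsRt c β → β ≤ θ

theorem hi_dom (H : CD c d r) {θ : I → ℤ} (h : H.Hi θ) (k : I) : 0 ≤ prZ c k θ := by
  have h1 := h.max _ (h.rt.s k) k
  rw [sZ_eq] at h1
  simp only [Pi.sub_apply, Pi.smul_apply, alphaZ_self, smul_eq_mul, mul_one] at h1
  linarith

theorem hi_pos [Nonempty I] (H : CD c d r) {θ : I → ℤ} (h : H.Hi θ) : 0 ≤ θ := by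
  intro k
  have := h.max _ (isRt_alpha k) k
  rw [alphaZ_self] at this
  simp only [Pi.zero_apply]; linarith

theorem rt_norm (H : CD c d r) (l : List I) (i : I) :
    BZ c d (actW c l (alphaZ i)) (actW c l (alphaZ i)) = 2 * d i := by
  rw [H.B_act, H.B_alpha_alpha, H.hdiag]; ring

theorem hi_long [Nonempty I] (H : CD c d r) {θ : I → ℤ} (h : H.Hi θ) : BZ c d θ θ = 2 * r := by
  classical
  obtain ⟨i, hi⟩ := H.hrmem
  set S := H.Ph.filter (fun β => BZ c d β β = 2 * r) with hS
  have hne : S.Nonempty := ⟨alphaZ i, by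
    rw [hS, Finset.mem_filter, H.mem_Ph]
    exact ⟨isRt_alpha i, by rw [H.B_alpha_alpha, H.hdiag, hi]; ring⟩⟩
  obtain ⟨β, hβ, hmax⟩ := S.exists_max_image (fun β => ∑ k, β k) hne
  rw [hS, Finset.mem_filter, H.mem_Ph] at hβ
  have hdom : ∀ k, 0 ≤ prZ c k β := by
    intro k
    have := hmax (sZ c k β) (by
      rw [hS, Finset.mem_filter, H.mem_Ph, H.B_s]
      exact ⟨hβ.1.s k, hβ.2⟩)
    rw [sZ_eq] at this
    simp only [Pi.sub_apply, Pi.smul_apply, smul_eq_mul, Finset.sum_sub_distrib,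
      ← Finset.mul_sum] at this
    have e : ∑ x, alphaZ k x = 1 := by simp [alphaZ]
    rw [e] at this
    linarith
  have h1 : 0 ≤ BZ c d (θ - β) (θ + β) := by
    refine H.B_nonneg_of (sub_nonneg.2 (h.max β hβ.1)) fun k => ?_
    rw [prZ_add]
    exact add_nonneg (H.hi_dom h k) (hdom k)
  rw [H.B_sub_left, H.B_add_right, H.B_add_right, H.B_comm β θ, hβ.2] at h1
  obtain ⟨l, j, hl⟩ := h.rt
  have h2 : BZ c d θ θ = 2 * d j := by rw [hl]; exact H.rt_norm l j
  have := H.hrmax j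
  linarith

theorem hi_pair [Nonempty I] (H : CD c d r) {θ : I → ℤ} (h : H.Hi θ) {β : I → ℤ}
    (hβ : β ∈ H.Pp) (hne : β ≠ θ) : BZ c d β θ ^ 2 = r * BZ c d β θ := by
  rw [H.mem_Pp] at hβ
  have h0 : 0 ≤ BZ c d β θ := H.B_nonneg_of hβ.2 (H.hi_dom h)
  obtain ⟨l, j, hl⟩ := h.rt
  have hj : d j = r := by
    have h2 : BZ c d θ θ = 2 * d j := by rw [hl]; exact H.rt_norm l j
    rw [H.hi_long h] at h2
    linarith
  have hdv : r ∣ BZ c d β θ := by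
    have h1 : ∀ k, r ∣ d k * θ k := by
      rw [hl, ← hj]; exact H.dvd_act (d j) _ (H.dvd_alpha j) l
    rw [H.B_comm, BZ]
    refine Finset.dvd_sum fun k _ => ?_
    have : θ k * (d k * prZ c k β) = (d k * θ k) * prZ c k β := by ring
    rw [this]
    exact Dvd.dvd.mul_right (h1 k) _
  have hlt : BZ c d β θ < 2 * r := by
    have h1 := H.B_pos (θ - β) (sub_ne_zero.2 (Ne.symm hne))
    rw [H.B_sub_left, H.B_sub_right, H.B_sub_right, H.B_comm θ β, H.hi_long h] at h1
    obtain ⟨m, k, hm⟩ := hβ.1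
    have h2 : BZ c d β β = 2 * d k := by rw [hm]; exact H.rt_norm m k
    have := H.hrmax k
    linarith
  obtain ⟨a, ha⟩ := hdv
  have hr : 0 < r := by rw [← hj]; exact H.hdpos j
  rw [ha] at h0 hlt ⊢
  have a0 : 0 ≤ a := nonneg_of_mul_nonneg_right h0 hr
  have a1 : a < 2 := by
    by_contra hc
    push Not at hc
    nlinarith
  have : a = 0 ∨ a = 1 := by omega
  rcases this with rfl | rfl <;> ring

/-- trace identity -/
theorem trace_id [Nonempty I] (H : CD c d r) {θ : I → ℤ} (h : H.Hi θ) (f : (I → ℤ) → ℤ)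
    (hf : ∀ i β, f (sZ c i β) = f β) (hfn : ∀ β, f (-β) = f β) :
    ∑ β ∈ H.Pp, f β * BZ c d β β
      = (Fintype.card I : ℤ) * (r * f θ + ∑ k, θ k * (f (alphaZ k) * d k)) := by
  classical
  -- the operator
  let A : (I → ℤ) → (I → ℤ) := fun x => ∑ β ∈ H.Ph, (f β * BZ c d β x) • β
  have Aadd : ∀ x y, A (x + y) = A x + A y := by
    intro x y
    simp only [A, ← Finset.sum_add_distrib]
    exact Finset.sum_congr rfl fun β _ => by rw [H.B_add_right]; module
  have Asmul : ∀ (a : ℤ) x, A (a • x) = a • A x := by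
    intro a x
    simp only [A, Finset.smul_sum]
    exact Finset.sum_congr rfl fun β _ => by rw [H.B_smul_right]; module
  have Acomm : ∀ i x, sZ c i (A x) = A (sZ c i x) := by
    intro i x
    have h1 := H.sum_Ph_s i (fun β => (f β * BZ c d β (sZ c i x)) • β)
    simp only [hf, H.B_s] at h1
    change sZ c i (∑ β ∈ H.Ph, (f β * BZ c d β x) • β) = ∑ β ∈ H.Ph, (f β * BZ c d β (sZ c i x)) • β
    rw [← h1, ← act_single, act_sum]
    exact Finset.sum_congr rfl fun β _ => by rw [act_smul]; rfl
  have Aalpha : ∀ i, 2 • A (alphaZ i) = prZ c i (A (alphaZ i)) • alphaZ i := by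
    intro i
    have h1 := Acomm i (alphaZ i)
    have e2 : -alphaZ i = (-1 : ℤ) • alphaZ i := by simp
    rw [H.s_alpha, e2, Asmul, sZ_eq] at h1
    have : A (alphaZ i) = (-1 : ℤ) • A (alphaZ i) + prZ c i (A (alphaZ i)) • alphaZ i := by
      rw [← h1]; module
    calc 2 • A (alphaZ i) = A (alphaZ i) + A (alphaZ i) := by module
      _ = ((-1 : ℤ) • A (alphaZ i) + prZ c i (A (alphaZ i)) • alphaZ i) + A (alphaZ i) := by
        rw [← this]
      _ = _ := by module
  have hconst : ∀ i j, prZ c i (A (alphaZ i)) = prZ c j (A (alphaZ j)) := by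
    refine H.conn_const (fun i => prZ c i (A (alphaZ i))) ?_
    intro i j hij hc
    have h1 := Acomm i (alphaZ j)
    have e1 : sZ c i (alphaZ j) = alphaZ j + (- c i j) • alphaZ i := by
      rw [sZ_eq, prZ_alpha]; module
    rw [e1, Aadd, Asmul, sZ_eq] at h1
    have h2 : prZ c i (2 • A (alphaZ j)) • alphaZ i = c i j • (2 • A (alphaZ i)) := by
      have e3 : prZ c i (2 • A (alphaZ j)) = 2 * prZ c i (A (alphaZ j)) := by
        have := prZ_smul (c := c) i 2 (A (alphaZ j))
        rw [← this]; congr 1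
      rw [e3]
      have h3 : prZ c i (A (alphaZ j)) • alphaZ i = c i j • A (alphaZ i) := by
        have := congrArg (fun z => A (alphaZ j) - z) h1
        calc _ = A (alphaZ j) - (A (alphaZ j) - prZ c i (A (alphaZ j)) • alphaZ i) := by module
          _ = _ := this
          _ = _ := by module
      rw [mul_smul, h3]; module
    rw [Aalpha i, Aalpha j, prZ_smul, prZ_alpha] at h2
    have h3 := congrFun h2 i
    simp only [Pi.smul_apply, alphaZ_self, smul_eq_mul, mul_one] at h3
    exact mul_left_cancel₀ hc (by linarith)
  obtain ⟨i0⟩ := ‹Nonempty I›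
  have : Nonempty I := ⟨i0⟩
  set p := prZ c i0 (A (alphaZ i0)) with hp
  have Ap : ∀ i k, 2 * A (alphaZ i) k = p * alphaZ i k := by
    intro i k
    have := congrFun (Aalpha i) k
    rw [hconst i i0] at this
    simpa using this
  -- trace
  have tr : (Fintype.card I : ℤ) * p = 2 * ∑ β ∈ H.Ph, f β * BZ c d β β := by
    have h1 : ∑ i, 2 * A (alphaZ i) i = (Fintype.card I : ℤ) * p := by
      simp only [Ap, alphaZ_self, mul_one, Finset.sum_const, Finset.card_univ, nsmul_eq_mul]
    rw [← h1, ← Finset.mul_sum]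
    congr 1
    simp only [A, Finset.sum_apply, Pi.smul_apply, smul_eq_mul]
    rw [Finset.sum_comm]
    refine Finset.sum_congr rfl fun β _ => ?_
    rw [H.B_decomp β β, Finset.mul_sum]
    exact Finset.sum_congr rfl fun k _ => by ring
  -- evaluate on θ
  have ev : p * BZ c d θ θ = 2 * ∑ β ∈ H.Ph, f β * BZ c d β θ ^ 2 := by
    have e1 : ∀ x : I → ℤ, ∀ k, 2 * A x k = p * x k := by
      intro x k
      have hx : A x = ∑ i, x i • A (alphaZ i) := by
        have key : ∀ s : Finset I, A (∑ i ∈ s, x i • alphaZ i) = ∑ i ∈ s, x i • A (alphaZ i) := by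
          intro s
          induction s using Finset.induction_on with
          | empty => have := Asmul 0 0; simpa using this
          | insert a s ha ih => rw [Finset.sum_insert ha, Finset.sum_insert ha, Aadd, Asmul, ih]
        have := key Finset.univ
        rwa [← vec_decomp x] at this
      rw [hx]
      simp only [Finset.sum_apply, Pi.smul_apply, smul_eq_mul, Finset.mul_sum]
      have : ∀ i, 2 * (x i * A (alphaZ i) k) = p * (x i * alphaZ i k) := by
        intro i; linear_combination x i * Ap i k
      simp only [this]
      rw [← Finset.mul_sum]
      congr 1
      have := congrFun (vec_decomp x) k
      rw [this]; simp [Finset.sum_apply]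
    have h2 : (2:ℤ) • A θ = p • θ := by funext k; simpa using e1 θ k
    have h3 : BZ c d θ (p • θ) = p * BZ c d θ θ := H.B_smul_right _ _ _
    rw [← h3, ← h2, H.B_smul_right]
    congr 1
    rw [H.B_comm, BZ]
    simp only [A, Finset.sum_apply, Pi.smul_apply, smul_eq_mul, Finset.sum_mul]
    rw [Finset.sum_comm]
    refine Finset.sum_congr rfl fun β _ => ?_
    calc _ = ∑ k, (f β * BZ c d β θ) * (β k * (d k * prZ c k θ)) :=
          Finset.sum_congr rfl fun k _ => by ring
      _ = (f β * BZ c d β θ) * BZ c d β θ := by rw [← Finset.mul_sum]; rfl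
      _ = _ := by ring
  rw [H.sum_Ph_even _ (fun β => by rw [hfn, H.B_neg_left, H.B_neg_right, neg_neg])] at tr
  rw [H.sum_Ph_even _ (fun β => by rw [hfn, H.B_neg_left]; ring), H.hi_long h] at ev
  -- the sum against θ
  have hθp : θ ∈ H.Pp := H.mem_Pp.2 ⟨h.rt, H.hi_pos h⟩
  have s1 : ∑ β ∈ H.Pp, f β * BZ c d β θ ^ 2
      = r * ∑ β ∈ H.Pp, f β * BZ c d β θ + 2 * r ^ 2 * f θ := by
    rw [← Finset.add_sum_erase _ _ hθp, ← Finset.add_sum_erase _ (fun β => f β * BZ c d β θ) hθp,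
      H.hi_long h, mul_add, Finset.mul_sum]
    have : ∑ β ∈ H.Pp.erase θ, f β * BZ c d β θ ^ 2
        = ∑ β ∈ H.Pp.erase θ, r * (f β * BZ c d β θ) := by
      refine Finset.sum_congr rfl fun β hβ => ?_
      rw [Finset.mem_erase] at hβ
      rw [H.hi_pair h hβ.2 hβ.1]; ring
    rw [this]; ring
  have s2 : ∀ i, ∑ β ∈ H.Pp, f β * BZ c d β (alphaZ i) = 2 * (f (alphaZ i) * d i) := by
    intro i
    rw [H.sum_split i]
    have e := H.sum_erase_s i (fun β => f β * BZ c d β (alphaZ i))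
    have e2 : ∀ β, f (sZ c i β) * BZ c d (sZ c i β) (alphaZ i) = - (f β * BZ c d β (alphaZ i)) := by
      intro β
      have : BZ c d (sZ c i β) (alphaZ i) = - BZ c d β (alphaZ i) := by
        rw [← H.B_s i, H.s_s, H.s_alpha, H.B_neg_right]
      rw [hf, this]; ring
    simp only [e2, Finset.sum_neg_distrib] at e
    have e3 : ∑ β ∈ H.Pp.erase (alphaZ i), f β * BZ c d β (alphaZ i) = 0 := by linarith
    rw [e3, H.B_alpha_alpha, H.hdiag]; ring
  have s3 : ∑ β ∈ H.Pp, f β * BZ c d β θ = 2 * ∑ k, θ k * (f (alphaZ k) * d k) := by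
    have : ∀ β, f β * BZ c d β θ = ∑ k, θ k * (f β * BZ c d β (alphaZ k)) := by
      intro β
      rw [H.B_decomp β θ, Finset.mul_sum]
      exact Finset.sum_congr rfl fun k _ => by ring
    simp only [this]
    rw [Finset.sum_comm, Finset.mul_sum]
    refine Finset.sum_congr rfl fun k _ => ?_
    rw [← Finset.mul_sum, s2]; ring
  have hr : 0 < r := lt_of_lt_of_le (H.hdpos i0) (H.hrmax i0)
  rw [s1, s3] at ev
  have hpv : p = 4 * (r * f θ + ∑ k, θ k * (f (alphaZ k) * d k)) :=
    mul_left_cancel₀ hr.ne' (by linarith)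
  rw [hpv] at tr
  linarith

/-- Sum of half norms over a reduced word of the longest element. -/
theorem word_sums [Nonempty I] (H : CD c d r) {θ : I → ℤ} (h : H.Hi θ) (l : List I) (hl : H.Red l)
    (hneg : ∀ i, actW c l.reverse (alphaZ i) ≤ 0) :
    2 * (l.length : ℤ) = Fintype.card I * (1 + ∑ k, θ k) ∧
    2 * (l.map d).sum = Fintype.card I * (r + ∑ k, θ k * d k) := by
  classical
  have hall : ∀ f, H.nf f l = ∑ β ∈ H.Pp, f β := by
    intro f
    refine Finset.sum_congr rfl fun β hβ => if_neg ?_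
    rw [H.mem_Pp] at hβ
    rw [H.not_nonneg_iff (hβ.1.act _), act_decomp]
    intro k
    rw [Finset.sum_apply]
    refine Finset.sum_nonpos fun i _ => ?_
    have h1 := hneg i k
    have h2 := hβ.2 i
    simp only [Pi.smul_apply, smul_eq_mul, Pi.zero_apply] at *
    exact mul_nonpos_of_nonneg_of_nonpos h2 h1
  constructor
  · -- f = 2 r / norm
    have hr : 0 < r := by
      obtain ⟨i, hi⟩ := H.hrmem
      rw [← hi]; exact H.hdpos i
    have t := H.trace_id h (fun β => 2 * r / BZ c d β β) (fun i β => by rw [H.B_s])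
      (fun β => by rw [H.B_neg_left, H.B_neg_right, neg_neg])
    have e1 : ∀ i, 2 * r / (2 * d i) * (2 * d i) = 2 * r := by
      intro i
      apply Int.ediv_mul_cancel
      rcases H.honer i with h1 | h1 <;> rw [h1]
      exact Dvd.intro r (by ring)
    have e2 : ∑ β ∈ H.Pp, 2 * r / BZ c d β β * BZ c d β β = ∑ β ∈ H.Pp, 2 * r := by
      refine Finset.sum_congr rfl fun β hβ => ?_
      obtain ⟨m, i, hm⟩ := (H.mem_Pp.1 hβ).1
      rw [hm, H.rt_norm, e1]
    have e3 : ∀ k, 2 * r / BZ c d (alphaZ k) (alphaZ k) * d k = r := by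
      intro k
      have h1 := e1 k
      have h2 : BZ c d (alphaZ k) (alphaZ k) = 2 * d k := by
        rw [H.B_alpha_alpha, H.hdiag]; ring
      rw [h2]; linarith
    have e4 : 2 * r / BZ c d θ θ = 1 := by
      rw [H.hi_long h]; exact Int.ediv_self (by linarith)
    rw [e2, e4] at t
    simp only [e3] at t
    have e5 := hall (fun _ => 1)
    have e6 : H.nf (fun _ => 1) l = l.length := hl
    rw [e6, Finset.sum_const, nsmul_eq_mul, mul_one] at e5
    rw [Finset.sum_const, nsmul_eq_mul, ← e5, ← Finset.sum_mul] at t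
    exact mul_left_cancel₀ hr.ne' (by linarith)
  · have t := H.trace_id h (fun _ => 1) (fun _ _ => rfl) (fun _ => rfl)
    simp only [one_mul, mul_one] at t
    rw [← t, ← hall (fun β => BZ c d β β), H.red_nf _ (fun i β => H.B_s i β β) l hl,
      ← List.sum_map_mul_left]
    congr 1
    refine List.map_congr_left fun i _ => ?_
    rw [H.B_alpha_alpha, H.hdiag]; ring

end CD
end

section
variable [Fintype I] [DecidableEq I] {R : Type} [CommRing R]

/-- the deformed reflection attached to a matrix `C` and scalars `z` -/
def tauM (C : Matrix I I R) (z : I → R) (i : I) : Matrix I I R :=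
  1 - z i • (Matrix.single i i (1 : R) * C)

theorem tauM_mulVec (C : Matrix I I R) (z : I → R) (i : I) (v : I → R) :
    (tauM C z i).mulVec v = v - (z i * (C.mulVec v) i) • (Pi.single i 1 : I → R) := by
  unfold tauM
  rw [Matrix.sub_mulVec, Matrix.one_mulVec, Matrix.smul_mulVec, ← Matrix.mulVec_mulVec,
    Matrix.single_mulVec]
  congr 1
  funext k
  by_cases h : k = i
  · subst h; simp
  · simp [h]

theorem tau_step_i (C : Matrix I I R) (z : I → R) (hz : ∀ i, z i * C i i = 1 + z i ^ 2)
    (i j : I) (v : I → R) (a b : R) :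
    (tauM C z i).mulVec (v - a • (Pi.single i 1 : I → R) - b • (Pi.single j 1 : I → R))
      = v - (z i * (C.mulVec v) i - z i ^ 2 * a - z i * C i j * b) • (Pi.single i 1 : I → R)
        - b • (Pi.single j 1 : I → R) := by
  rw [tauM_mulVec, Matrix.mulVec_sub, Matrix.mulVec_sub, Matrix.mulVec_smul, Matrix.mulVec_smul]
  simp only [Matrix.mulVec_single_one, Pi.sub_apply, Pi.smul_apply, Matrix.col_apply, smul_eq_mul]
  have h := hz i
  have e : z i * ((C.mulVec v) i - a * C i i - b * C i j) =
     z i * (C.mulVec v) i - z i ^ 2 * a - z i * C i j * b - a := by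
    linear_combination (-a) * h
  rw [e]
  module

theorem tau_step_j (C : Matrix I I R) (z : I → R) (hz : ∀ i, z i * C i i = 1 + z i ^ 2)
    (i j : I) (v : I → R) (a b : R) :
    (tauM C z j).mulVec (v - a • (Pi.single i 1 : I → R) - b • (Pi.single j 1 : I → R))
      = v - a • (Pi.single i 1 : I → R)
        - (z j * (C.mulVec v) j - z j ^ 2 * b - z j * C j i * a) • (Pi.single j 1 : I → R) := by
  have := tau_step_i C z hz j i v b a
  rw [sub_right_comm, this, sub_right_comm]

/-- the rank two relations -/
def braidRel (C : Matrix I I R) (z : I → R) (m : ℕ) (i j : I) : Prop :=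
  (m = 2 ∧ C i j = 0 ∧ C j i = 0) ∨ (m = 3 ∧ C i j * C j i = 1 ∧ z i = z j) ∨
  (m = 4 ∧ z i * C i j * (z j * C j i) = z i ^ 2 + z j ^ 2) ∨
  (m = 6 ∧ z i * C i j * (z j * C j i) = z i ^ 2 + z i * z j + z j ^ 2)

theorem braid (C : Matrix I I R) (z : I → R) (hz : ∀ i, z i * C i i = 1 + z i ^ 2)
    {m : ℕ} {i j : I} (h : braidRel C z m i j) :
    ((altW m i j).map (tauM C z)).prod = ((altW m j i).map (tauM C z)).prod := by
  apply Matrix.ext_of_mulVec_single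
  intro k
  set v : I → R := Pi.single k 1
  have hv : v = v - (0 : R) • (Pi.single i 1 : I → R) - (0 : R) • (Pi.single j 1 : I → R) := by simp
  rw [hv]
  have key : ∀ a b a' b' : R, a = a' → b = b' →
      v - a • (Pi.single i 1 : I → R) - b • (Pi.single j 1 : I → R)
        = v - a' • (Pi.single i 1 : I → R) - b' • (Pi.single j 1 : I → R) := by
    rintro a b _ _ rfl rfl; rfl
  have h' : (m = 2 ∧ z i * C i j = 0 ∧ z j * C j i = 0) ∨
      (m = 3 ∧ z i * C i j * (z j * C j i) = z i * z j ∧ z i = z j) ∨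
      (m = 4 ∧ z i * C i j * (z j * C j i) = z i ^ 2 + z j ^ 2) ∨
      (m = 6 ∧ z i * C i j * (z j * C j i) = z i ^ 2 + z i * z j + z j ^ 2) := by
    rcases h with ⟨h0, h1, h2⟩ | ⟨h0, h1, h2⟩ | h | h
    · exact Or.inl ⟨h0, by rw [h1, mul_zero], by rw [h2, mul_zero]⟩
    · exact Or.inr (Or.inl ⟨h0, by linear_combination (z i * z j) * h1, h2⟩)
    · exact Or.inr (Or.inr (Or.inl h))
    · exact Or.inr (Or.inr (Or.inr h))
  clear h hv
  rcases h' with ⟨rfl, h1, h2⟩ | ⟨rfl, h1, h2⟩ | ⟨rfl, h1⟩ | ⟨rfl, h1⟩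
  all_goals
    simp only [altW, List.map_cons, List.map_nil, List.prod_cons, List.prod_nil,
      mul_one, ← Matrix.mulVec_mulVec, Matrix.one_mulVec, tau_step_i C z hz i j v,
      tau_step_j C z hz i j v]
    refine key _ _ _ _ ?_ ?_
    all_goals
      clear key
      generalize z i * (C.mulVec v) i = F
      generalize z j * (C.mulVec v) j = G
      clear hz
      generalize z i * C i j = X at *
      generalize z j * C j i = Y at *
      clear v
      generalize z i = A at *
      generalize z j = B at *
      grind

end

section
variable [Fintype I] [DecidableEq I] {R : Type} [CommRing R]
  {c : I → I → ℤ} {d : I → ℤ} {r : ℤ}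

theorem tau_det (C : Matrix I I R) (z : I → R) (hz : ∀ i, z i * C i i = 1 + z i ^ 2) (i : I) :
    (tauM C z i).det = - z i ^ 2 := by
  have e : tauM C z i = 1 + Matrix.replicateCol Unit (Pi.single i (- z i) : I → R) *
      Matrix.replicateRow Unit (C i) := by
    unfold tauM
    ext a b
    by_cases h : a = i
    · subst h; simp [Matrix.mul_apply, Matrix.single_apply, sub_eq_add_neg]
    · simp [Matrix.mul_apply, Matrix.single_apply, h, Ne.symm h]
  rw [e, Matrix.det_one_add_replicateCol_mul_replicateRow]
  simp only [dotProduct_single]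
  linear_combination (-1 : R) * hz i

theorem tau_prod_det (C : Matrix I I R) (z : I → R) (hz : ∀ i, z i * C i i = 1 + z i ^ 2)
    (l : List I) : ((l.map (tauM C z)).prod.det) ^ 2 = (l.map z).prod ^ 4 := by
  induction l with
  | nil => simp
  | cons i l ih =>
    rw [List.map_cons, List.prod_cons, Matrix.det_mul, mul_pow, ih, tau_det C z hz,
      List.map_cons, List.prod_cons]
    ring

/-- a product of deformed reflections is `1 - p C` -/
theorem tau_prod_form (C : Matrix I I R) (z : I → R) (l : List I) :
    ∃ p : Matrix I I R, (l.map (tauM C z)).prod = 1 - p * C := by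
  induction l with
  | nil => exact ⟨0, by simp⟩
  | cons i l ih =>
    obtain ⟨p, hp⟩ := ih
    refine ⟨p + z i • Matrix.single i i (1 : R) - z i • Matrix.single i i (1 : R) * C * p, ?_⟩
    rw [List.map_cons, List.prod_cons, hp, tauM]
    simp only [Matrix.smul_mul, sub_mul, mul_sub, add_mul, one_mul, mul_one, Matrix.mul_assoc]
    abel

/-- deformation data -/
structure QD (c : I → I → ℤ) (C : Matrix I I R) (z : I → R) (ev : R →+* ℚ) : Prop where
  hz : ∀ i, z i * C i i = 1 + z i ^ 2
  hbr : ∀ i j, i ≠ j → braidRel C z (mW c i j) i j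
  hevC : ∀ i j, ev (C i j) = c i j
  hevz : ∀ i, ev (z i) = 1

theorem QD.ev_act {C : Matrix I I R} {z : I → R} {ev : R →+* ℚ} (Q : QD c C z ev) (l : List I)
    (x : I → ℤ) (k : I) :
    ev (((l.map (tauM C z)).prod.mulVec (fun i => (x i : R))) k) = actW c l x k := by
  induction l generalizing k with
  | nil => simp [actW]
  | cons i l ih =>
    rw [List.map_cons, List.prod_cons, ← Matrix.mulVec_mulVec, tauM_mulVec, actW, sZ_eq]
    generalize hy : (l.map (tauM C z)).prod.mulVec (fun i => (x i : R)) = y at ih ⊢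
    simp only [Pi.sub_apply, Pi.smul_apply, map_sub, ih, smul_eq_mul, map_mul, Q.hevz,
      Matrix.mulVec, dotProduct, map_sum, Q.hevC, prZ, alphaZ, Pi.single_apply, one_mul]
    push_cast
    split_ifs <;> simp

theorem CD.w0_conj [Nonempty I] (H : CD c d r) {l0 : List I} {istar : I → I}
    (hstar : ∀ i, actW c l0 (alphaZ i) = - alphaZ (istar i))
    {M : Type} [Monoid M] (τ : I → M)
    (hτ : ∀ i j, i ≠ j → ((altW (mW c i j) i j).map τ).prod = ((altW (mW c i j) j i).map τ).prod)
    (l1 : List I) (h1 : H.Red l1) (h10 : actW c l1 = actW c l0) (i : I) :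
    (l1.map τ).prod * τ i = τ (istar i) * (l1.map τ).prod := by
  obtain ⟨x, hx, hxa, -⟩ := H.exists_red _ (istar i :: l0) le_rfl
  have xa : actW c x (alphaZ i) = alphaZ (istar i) := by
    rw [hxa]; simp only [actW, hstar]
    have := H.s_alpha (istar i)
    have h2 := H.s_s (istar i) (alphaZ (istar i))
    rw [this] at h2; exact h2
  have e1 : actW c (istar i :: x) = actW c l1 := by
    funext y; rw [h10]; simp only [actW, hxa, H.s_s]
  have r1 : H.Red (istar i :: x) := by
    rw [H.red_cons]
    refine ⟨hx, ?_⟩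
    rw [← xa, H.rev_act]; exact alphaZ_nonneg i
  have e2 : actW c (x ++ [i]) = actW c l1 := by
    rw [← e1]; funext y
    rw [act_append, act_single]
    have := H.reflection_conj xa (actW c x y)
    rwa [H.rev_act] at this
  have r2 : H.Red (x ++ [i]) := by
    unfold CD.Red CD.nn at r1 ⊢
    rw [H.nf_congr _ (e2.trans e1.symm), r1]; simp
  have p1 := H.matsumoto τ hτ _ _ _ rfl h1 r1 e1.symm
  have p2 := H.matsumoto τ hτ _ _ _ rfl h1 r2 e2.symm
  rw [List.map_cons, List.prod_cons] at p1
  rw [List.map_append, List.prod_append, List.map_singleton, List.prod_singleton] at p2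
  conv_lhs => rw [p1]
  conv_rhs => rw [p2]
  rw [mul_assoc]

/-- the deformed longest element is a multiple of a permutation -/
theorem CD.w0_form [Nonempty I] [IsDomain R] (H : CD c d r) {l0 : List I} {istar : I → I}
    (hstar : ∀ i, actW c l0 (alphaZ i) = - alphaZ (istar i))
    (hinv : Function.Involutive istar)
    {C : Matrix I I R} {z : I → R} {ev : R →+* ℚ} (Q : QD c C z ev)
    (hzs : ∀ i, z (istar i) = z i) (hCs : ∀ i j, C (istar i) (istar j) = C i j)
    (l1 : List I) (h1 : H.Red l1) (h10 : actW c l1 = actW c l0) :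
    ∃ a : R, ev a = -1 ∧
      (l1.map (tauM C z)).prod = Matrix.of fun i j => if i = istar j then a else 0 := by
  set T := (l1.map (tauM C z)).prod with hT
  have hc := fun i => H.w0_conj hstar (tauM C z) (fun i j hij => braid C z Q.hz (Q.hbr i j hij))
    l1 h1 h10 i
  have hz2 : ∀ i, 1 + z i ^ 2 ≠ 0 := by
    intro i h
    have := congrArg ev h
    simp [Q.hevz] at this
  have hcol : ∀ i k, k ≠ istar i → T k i = 0 := by
    intro i k hk
    have h2 := congrFun (congrArg (fun A => A.mulVec (Pi.single i 1 : I → R)) (hc i)) k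
    simp only [← Matrix.mulVec_mulVec, ← hT] at h2
    rw [tauM_mulVec, tauM_mulVec, Matrix.mulVec_sub, Matrix.mulVec_smul] at h2
    simp only [Matrix.mulVec_single_one, Pi.sub_apply, Pi.smul_apply, Matrix.col_apply, smul_eq_mul,
      Pi.single_apply, if_neg hk, mul_zero, sub_zero, Q.hz] at h2
    have : (1 + z i ^ 2) * T k i = 0 := by linear_combination - h2
    exact (mul_eq_zero.1 this).resolve_left (hz2 i)
  have hTi : ∀ i, T.mulVec (Pi.single i 1 : I → R) = T (istar i) i • (Pi.single (istar i) 1 : I → R) := by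
    intro i
    funext k
    simp only [Matrix.mulVec_single_one, Matrix.col_apply, Pi.smul_apply, Pi.single_apply, smul_eq_mul]
    split_ifs with h
    · rw [h, mul_one]
    · rw [hcol i k h, mul_zero]
  have hconst : ∀ i j, T (istar i) i = T (istar j) j := by
    refine H.conn_const (fun i => T (istar i) i) ?_
    intro i j hij hcij
    have h2 := congrFun (congrArg (fun A => A.mulVec (Pi.single j 1 : I → R)) (hc i)) (istar i)
    have hCi : (C.mulVec (Pi.single (istar j) 1 : I → R)) (istar i) = C i j := by
      rw [Matrix.mulVec_single_one, Matrix.col_apply, hCs]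
    have hCj : (C.mulVec (Pi.single j 1 : I → R)) i = C i j := by
      rw [Matrix.mulVec_single_one, Matrix.col_apply]
    have hne : istar i ≠ istar j := fun h => hij (hinv.injective h)
    simp only [← Matrix.mulVec_mulVec, ← hT] at h2
    rw [hTi j, tauM_mulVec, tauM_mulVec, hCj, Matrix.mulVec_sub, Matrix.mulVec_smul, hTi j, hTi i,
      Matrix.mulVec_smul] at h2
    simp only [Pi.sub_apply, Pi.smul_apply, smul_eq_mul, hCi, Pi.single_apply, if_true,
      if_neg hne, mul_zero, mul_one, zero_sub, hzs] at h2
    have h3 : (z i * C i j) * (T (istar i) i - T (istar j) j) = 0 := by linear_combination - h2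
    have h4 : z i * C i j ≠ 0 := by
      intro h
      have := congrArg ev h
      rw [map_mul, Q.hevz, Q.hevC, one_mul, map_zero] at this
      exact hcij (by exact_mod_cast this)
    exact sub_eq_zero.1 ((mul_eq_zero.1 h3).resolve_left h4)
  obtain ⟨i0⟩ := ‹Nonempty I›
  refine ⟨T (istar i0) i0, ?_, ?_⟩
  · have := Q.ev_act l1 (alphaZ i0) (istar i0)
    rw [h10, hstar] at this
    have e : (fun i => ((alphaZ i0 i : ℤ) : R)) = (Pi.single i0 1 : I → R) := by
      funext k; simp only [alphaZ, Pi.single_apply]; split_ifs <;> simp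
    rw [e, ← hT, hTi] at this
    simpa [alphaZ] using this
  · ext i j
    rw [Matrix.of_apply]
    split_ifs with h
    · rw [h]; exact hconst j i0
    · exact hcol j i h

end

/-- Laurent polynomials in two variables -/
abbrev RR : Type := AddMonoidAlgebra ℚ (ℤ × ℤ)

/-- the monomial `q^u t^v` -/
def mon (u v : ℤ) : RR := AddMonoidAlgebra.single (u, v) 1

theorem mon_mul (u v u' v' : ℤ) : mon u v * mon u' v' = mon (u + u') (v + v') := by
  simp [mon, AddMonoidAlgebra.single_mul_single]

theorem mon_zero : mon 0 0 = 1 := rfl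

theorem mon_pow (u v : ℤ) (n : ℕ) : mon u v ^ n = mon (n * u) (n * v) := by
  simp [mon, AddMonoidAlgebra.single_pow]

/-- evaluation at `q = t = 1` -/
def evR : RR →+* ℚ := (AddMonoidAlgebra.lift ℚ ℚ (ℤ × ℤ) 1).toRingHom

theorem evR_mon (u v : ℤ) : evR (mon u v) = 1 := by
  simp [evR, mon, AddMonoidAlgebra.lift_single]

/-- the bar involution -/
def barR : RR →+* RR := AddMonoidAlgebra.mapDomainRingHom ℚ (negAddMonoidHom : ℤ × ℤ →+ ℤ × ℤ)

theorem barR_single (m : ℤ × ℤ) (a : ℚ) :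
    barR (AddMonoidAlgebra.single m a) = AddMonoidAlgebra.single (-m) a := by
  simp [barR]

theorem barR_mon (u v : ℤ) : barR (mon u v) = mon (-u) (-v) := by
  simp [mon, barR_single]

theorem barR_coeff (P : RR) (m : ℤ × ℤ) : (barR P).coeff m = P.coeff (-m) := by
  induction P using AddMonoidAlgebra.induction_linear with
  | zero => simp
  | add x y hx hy => simp [hx, hy]
  | single k a =>
    rw [barR_single]
    simp only [AddMonoidAlgebra.coeff_single, Finsupp.single_apply]
    congr 1
    rw [neg_eq_iff_eq_neg]

/-- the homomorphism on monomials -/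
def monL : Multiplicative (ℤ × ℤ) →* LL where
  toFun m := HahnSeries.single (-(m.toAdd.2)) (HahnSeries.single m.toAdd.1 (1 : ℚ))
  map_one' := by simp
  map_mul' x y := by
    rw [HahnSeries.single_mul_single, HahnSeries.single_mul_single]
    simp [add_comm]

/-- embedding of Laurent polynomials into iterated Laurent series -/
def iotaR : RR →+* LL := (AddMonoidAlgebra.lift ℚ LL (ℤ × ℤ) monL).toRingHom

theorem iotaR_single (u v : ℤ) (a : ℚ) : iotaR (AddMonoidAlgebra.single (u, v) a) =
    HahnSeries.single (-v) (HahnSeries.single u a) := by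
  have h : iotaR (AddMonoidAlgebra.single (u, v) a) =
      algebraMap ℚ LL a * monL (Multiplicative.ofAdd (u, v)) := by
    rw [← Algebra.smul_def]; exact AddMonoidAlgebra.lift_single _ _ _
  have h2 : algebraMap ℚ LL = (HahnSeries.C : FF →+* LL).comp (HahnSeries.C : ℚ →+* FF) :=
    Subsingleton.elim _ _
  rw [h, h2, RingHom.comp_apply, HahnSeries.C_apply, HahnSeries.C_apply]
  change _ * HahnSeries.single (-v) (HahnSeries.single u (1 : ℚ)) = _
  rw [HahnSeries.single_mul_single, HahnSeries.single_mul_single]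
  simp

theorem iotaR_mon (u v : ℤ) : iotaR (mon u v) = HahnSeries.single (-v) (HahnSeries.single u 1) :=
  iotaR_single u v 1

theorem iotaR_coeff (P : RR) (u v : ℤ) : dcoeff (iotaR P) u v = P.coeff (u, v) := by
  unfold dcoeff
  induction P using AddMonoidAlgebra.induction_linear with
  | zero => simp
  | add x y hx hy => simp [hx, hy]
  | single k a =>
    obtain ⟨k1, k2⟩ := k
    rw [iotaR_single]
    simp only [AddMonoidAlgebra.coeff_single, Finsupp.single_apply, HahnSeries.coeff_single,
      Prod.mk.injEq]
    by_cases h2 : k2 = v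
    · subst h2
      by_cases h1 : k1 = u
      · subst h1; simp
      · have : ¬ u = k1 := fun h => h1 h.symm
        simp [h1, this, HahnSeries.coeff_single]
    · have : ¬ -v = -k2 := fun h => h2 (by omega)
      simp [h2, this]

/-- quantum integers with small non-positive argument -/
def lqR (k : ℤ) : RR :=
  if k = 0 then 0 else if k = -1 then -1 else if k = -2 then -(mon 1 0 + mon (-1) 0)
  else -(mon 2 0 + 1 + mon (-2) 0)

theorem lqR_bar (k : ℤ) : barR (lqR k) = lqR k := by
  unfold lqR
  split_ifs <;> simp [barR_mon] <;> ring

/-- the deformed Cartan matrix over Laurent polynomials -/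
def CR [DecidableEq I] (c : I → I → ℤ) (d : I → ℤ) : Matrix I I RR :=
  Matrix.of fun i j => if i = j then mon (d i) (-1) + mon (-d i) 1 else lqR (c i j)

theorem CR_bar [DecidableEq I] (c : I → I → ℤ) (d : I → ℤ) (i j : I) :
    barR (CR c d i j) = CR c d i j := by
  unfold CR
  simp only [Matrix.of_apply]
  split_ifs
  · simp [barR_mon, add_comm]
  · exact lqR_bar _

section
variable [Fintype I] [DecidableEq I] {c : I → I → ℤ} {d : I → ℤ} {r : ℤ}

theorem CD.qd [Nonempty I] (H : CD c d r) :
    QD c (CR c d) (fun i => mon (-d i) 1) evR where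
  hz i := by
    simp only [CR, Matrix.of_apply, if_true, mul_add, mon_mul, pow_two]
    rw [← mon_zero]; ring_nf
  hbr i j hij := by
    have hji := hij.symm
    unfold braidRel
    simp only [CR, Matrix.of_apply, if_neg hij, if_neg hji]
    rcases H.rank_two hij with ⟨h1, h2⟩ | ⟨h1, h2, h3⟩ | ⟨h1, h2, h3, h4⟩ | ⟨h1, h2, h3, h4⟩ |
      ⟨h1, h2, h3, h4⟩ | ⟨h1, h2, h3, h4⟩
    · left; simp [mW, h1, h2, lqR]
    · right; left; simp [mW, h1, h2, h3, lqR]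
    · right; right; left; simp [mW, h1, h2, h3, h4, lqR, mul_add, mon_mul, pow_two]; try ring
    · right; right; left; simp [mW, h1, h2, h3, h4, lqR, add_mul, mul_add, mon_mul, pow_two]; try ring
    · right; right; right
      simp [mW, h1, h2, h3, h4, lqR, add_mul, mul_add, mon_mul, pow_two]; try ring
    · right; right; right
      simp [mW, h1, h2, h3, h4, lqR, add_mul, mul_add, mon_mul, pow_two]; try ring
  hevC i j := by
    by_cases hij : i = j
    · subst hij; simp [CR, evR_mon, H.hdiag]; norm_num
    · simp only [CR, Matrix.of_apply, if_neg hij]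
      rcases H.rank_two hij with ⟨h1, h2⟩ | ⟨h1, h2, h3⟩ | ⟨h1, h2, h3, h4⟩ | ⟨h1, h2, h3, h4⟩ |
        ⟨h1, h2, h3, h4⟩ | ⟨h1, h2, h3, h4⟩ <;> simp [lqR, h1, evR_mon] <;> norm_num
  hevz i := evR_mon _ _


/-- permutation matrix of the star involution -/
def sigM {R : Type} [CommRing R] (istar : I → I) : Matrix I I R :=
  Matrix.of fun i j => if i = istar j then 1 else 0

theorem sigM_sq {R : Type} [CommRing R] {istar : I → I} (hinv : Function.Involutive istar) :
    (sigM istar : Matrix I I R) * sigM istar = 1 := by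
  ext i j
  simp only [sigM, Matrix.mul_apply, Matrix.of_apply, mul_ite, mul_one, mul_zero,
    Finset.sum_ite_eq', Finset.mem_univ, if_true, Matrix.one_apply]
  simp [hinv j]

theorem CD.star_d [Nonempty I] (H : CD c d r) {l0 : List I} {istar : I → I}
    (hstar : ∀ i, actW c l0 (alphaZ i) = - alphaZ (istar i)) (i : I) : d (istar i) = d i := by
  have := H.B_act l0 (alphaZ i) (alphaZ i)
  rw [hstar, H.B_neg_left, H.B_neg_right, neg_neg, H.B_alpha_alpha, H.B_alpha_alpha,
    H.hdiag, H.hdiag] at this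
  omega

theorem CD.star_c [Nonempty I] (H : CD c d r) {l0 : List I} {istar : I → I}
    (hstar : ∀ i, actW c l0 (alphaZ i) = - alphaZ (istar i)) (i j : I) :
    c (istar i) (istar j) = c i j := by
  have := H.B_act l0 (alphaZ i) (alphaZ j)
  rw [hstar, hstar, H.B_neg_left, H.B_neg_right, neg_neg, H.B_alpha_alpha, H.B_alpha_alpha,
    H.star_d hstar] at this
  exact mul_left_cancel₀ (H.hdpos i).ne' this

theorem CD.star_CR [Nonempty I] (H : CD c d r) {l0 : List I} {istar : I → I}
    (hstar : ∀ i, actW c l0 (alphaZ i) = - alphaZ (istar i)) (hinv : Function.Involutive istar)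
    (i j : I) : CR c d (istar i) (istar j) = CR c d i j := by
  simp only [CR, Matrix.of_apply, hinv.injective.eq_iff, H.star_d hstar, H.star_c hstar]

theorem mon_prod (l : List I) : (l.map fun i => mon (-d i) 1).prod
    = mon (-(l.map d).sum) l.length := by
  induction l with
  | nil => rfl
  | cons i l ih =>
    rw [List.map_cons, List.prod_cons, ih, mon_mul, List.map_cons, List.sum_cons, List.length_cons]
    congr 1
    · ring
    · push_cast; ring

theorem CD.main_R [Nonempty I] (H : CD c d r) {θ : I → ℤ} (hθ : H.Hi θ)
    {l0 : List I} {istar : I → I}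
    (hstar : ∀ i, actW c l0 (alphaZ i) = - alphaZ (istar i)) (hinv : Function.Involutive istar) :
    ∃ p : Matrix I I RR, p * CR c d =
      1 + mon (-(r + ∑ k, θ k * d k)) (1 + ∑ k, θ k) • sigM istar := by
  obtain ⟨l1, h1, h10, -⟩ := H.exists_red _ l0 le_rfl
  set N := r + ∑ k, θ k * d k with hN
  set h := 1 + ∑ k, θ k with hh
  obtain ⟨a, hea, hT⟩ := H.w0_form hstar hinv H.qd
    (fun i => by rw [H.star_d hstar]) (H.star_CR hstar hinv) l1 h1 h10
  have hT' : (l1.map (tauM (CR c d) fun i => mon (-d i) 1)).prod = a • sigM istar := by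
    rw [hT]; ext i j; simp [sigM]
  obtain ⟨w1, w2⟩ := H.word_sums hθ l1 h1 (by
    intro i
    have e : actW c l1.reverse (actW c l1 (alphaZ (istar i))) = alphaZ (istar i) := H.rev_act _ _
    rw [h10, hstar, hinv i, act_neg] at e
    have : actW c l1.reverse (alphaZ i) = - alphaZ (istar i) := by rw [← e, neg_neg]
    rw [this]
    exact neg_nonpos.2 (alphaZ_nonneg _))
  have hdet := tau_prod_det (CR c d) (fun i => mon (-d i) 1) H.qd.hz l1
  have hs2 : (sigM istar : Matrix I I RR).det ^ 2 = 1 := by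
    rw [pow_two, ← Matrix.det_mul, sigM_sq hinv, Matrix.det_one]
  rw [hT', Matrix.det_smul, mul_pow, hs2, mul_one, mon_prod, mon_pow] at hdet
  set n := Fintype.card I with hn
  have hn0 : 0 < n := Fintype.card_pos
  set b := a * mon N (-h) with hb
  have hab : a = b * mon (-N) h := by
    rw [hb, mul_assoc, mon_mul]; simp [mon_zero]
  have hb2 : (b ^ 2) ^ n = 1 := by
    have : (b ^ 2) ^ n = (a ^ n) ^ 2 * mon N (-h) ^ (2 * n) := by rw [hb]; ring
    rw [this, hdet, mon_pow, mon_mul, ← mon_zero]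
    congr 1
    · push_cast; linear_combination (-2) * w2
    · push_cast; linear_combination 2 * w1
  have heb : evR b = -1 := by rw [hb, map_mul, hea, evR_mon, mul_one]
  have hb1 : b ^ 2 = 1 := by
    have h3 := geom_sum_mul (b ^ 2) n
    rw [hb2, sub_self] at h3
    rcases mul_eq_zero.1 h3 with h4 | h4
    · exfalso
      have := congrArg evR h4
      simp [heb] at this
      omega
    · exact sub_eq_zero.1 h4
  have hbm : b = -1 := by
    rcases (sq_eq_sq_iff_eq_or_eq_neg.1 (hb1.trans (one_pow 2).symm)) with h4 | h4
    · rw [h4, map_one] at heb; norm_num at heb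
    · exact h4
  obtain ⟨p, hp⟩ := tau_prod_form (CR c d) (fun i => mon (-d i) 1) l1
  refine ⟨p, ?_⟩
  rw [hT', hab, hbm] at hp
  have : p * CR c d = 1 - (-1 * mon (-N) h) • sigM istar := by rw [hp]; abel
  rw [this, neg_one_mul, neg_smul, sub_neg_eq_add]

end

theorem iotaR_mon_zpow (u v : ℤ) (n : ℤ) : iotaR (mon u v) ^ n = iotaR (mon (n * u) (n * v)) := by
  have hinv : ∀ a b : ℤ, (iotaR (mon a b))⁻¹ = iotaR (mon (-a) (-b)) := by
    intro a b
    refine inv_eq_of_mul_eq_one_right ?_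
    rw [← map_mul, mon_mul]
    simp [mon_zero]
  cases n with
  | ofNat n => rw [Int.ofNat_eq_natCast, zpow_natCast, ← map_pow, mon_pow]
  | negSucc n =>
    rw [zpow_negSucc, ← map_pow, mon_pow, hinv, Int.negSucc_eq]
    congr 2 <;> push_cast <;> ring

theorem qL_eq : qL = iotaR (mon 1 0) := by
  rw [iotaR_mon, qL, HahnSeries.C_apply, neg_zero]

theorem tL_eq : tL = iotaR (mon 0 1) := by
  rw [iotaR_mon, tL]; rfl

theorem qL_zpow (n : ℤ) : qL ^ n = iotaR (mon n 0) := by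
  rw [qL_eq, iotaR_mon_zpow]; simp

theorem tL_inv : tL⁻¹ = iotaR (mon 0 (-1)) := by
  rw [← zpow_neg_one, tL_eq, iotaR_mon_zpow]; simp

theorem q_sub_ne : iotaR (mon 1 0 - mon (-1) 0) ≠ 0 := by
  intro h
  have := iotaR_coeff (mon 1 0 - mon (-1) 0) 1 0
  rw [h] at this
  simp [dcoeff, mon, AddMonoidAlgebra.coeff_single, Finsupp.single_apply] at this

theorem phi_qint (φ : KK →+* LL) (hφq : φ qv = qL) (k : ℤ)
    (hk : k = 0 ∨ k = -1 ∨ k = -2 ∨ k = -3) : φ (qint k) = iotaR (lqR k) := by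
  unfold qint
  rw [map_div₀, map_sub, map_sub, map_zpow₀, map_zpow₀, map_inv₀, hφq, ← zpow_neg_one qL,
    qL_zpow, qL_zpow, qL_zpow]
  have e : qL = iotaR (mon 1 0) := qL_eq
  rw [e, ← map_sub, ← map_sub, div_eq_iff q_sub_ne, ← map_mul]
  congr 1
  rcases hk with rfl | rfl | rfl | rfl
  · simp [lqR]
  · simp [lqR]
  · simp [lqR, add_mul, mul_sub, mon_mul]; try ring
  · simp [lqR, add_mul, mul_sub, mon_mul]; try ring

theorem dcoeff_mon_mul (a b : ℤ) (y : LL) (u v : ℤ) :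
    dcoeff (iotaR (mon a b) * y) u v = dcoeff y (u - a) (v - b) := by
  unfold dcoeff
  rw [iotaR_mon, HahnSeries.coeff_single_mul, HahnSeries.coeff_single_mul, one_mul]
  congr 2; ring

theorem dcoeff_add (x y : LL) (u v : ℤ) : dcoeff (x + y) u v = dcoeff x u v + dcoeff y u v := by
  simp [dcoeff]

theorem lqR_single (k : ℤ) : ∃ g : FF, iotaR (lqR k) = HahnSeries.single 0 g := by
  unfold lqR
  split_ifs
  · exact ⟨0, by simp⟩
  · exact ⟨-1, by simp⟩
  · exact ⟨-(HahnSeries.single 1 1 + HahnSeries.single (-1) 1), by simp [iotaR_mon]⟩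
  · refine ⟨-(HahnSeries.single 2 1 + 1 + HahnSeries.single (-2) 1), ?_⟩
    simp [iotaR_mon]

section
variable [Fintype I] [DecidableEq I] {c : I → I → ℤ} {d : I → ℤ} {r : ℤ}

/-- the deformed Cartan matrix over iterated Laurent series -/
def CL (c : I → I → ℤ) (d : I → ℤ) : Matrix I I LL := (CR c d).map iotaR

theorem phi_Cqt [Nonempty I] (H : CD c d r) (φ : KK →+* LL) (hφq : φ qv = qL) (hφt : φ tv = tL) :
    (Matrix.of (Cqt c d)).map φ = CL c d := by
  ext1 i j
  simp only [CL, CR, Matrix.map_apply, Matrix.of_apply, Cqt]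
  split_ifs with hij
  · rw [map_add, map_mul, map_mul, map_zpow₀, map_zpow₀, map_inv₀, hφq, hφt, qL_zpow, qL_zpow,
      tL_inv, tL_eq, ← map_mul, ← map_mul, ← map_add, mon_mul, mon_mul]
    simp
  · apply phi_qint φ hφq
    rcases H.rank_two hij with ⟨h1, h2⟩ | ⟨h1, h2, h3⟩ | ⟨h1, h2, h3, h4⟩ | ⟨h1, h2, h3, h4⟩ |
      ⟨h1, h2, h3, h4⟩ | ⟨h1, h2, h3, h4⟩ <;> omega

theorem CL_step (c : I → I → ℤ) (d : I → ℤ) (x : I → LL) (n : ℤ) (i : I)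
    (h1 : ∀ k, (x k).coeff (n - 1) = 0) (h2 : (x i).coeff (n - 2) = 0)
    (h3 : ((CL c d).mulVec x i).coeff (n - 1) = 0) : (x i).coeff n = 0 := by
  rw [Matrix.mulVec, dotProduct, ← Finset.add_sum_erase _ _ (Finset.mem_univ i),
    HahnSeries.coeff_add] at h3
  have hs : (∑ k ∈ Finset.univ.erase i, CL c d i k * x k).coeff (n - 1) = 0 := by
    rw [HahnSeries.coeff_sum]
    refine Finset.sum_eq_zero fun k hk => ?_
    have hk' : i ≠ k := (Finset.ne_of_mem_erase hk).symm
    obtain ⟨g, hg⟩ := lqR_single (c i k)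
    have : CL c d i k = HahnSeries.single 0 g := by
      simp only [CL, CR, Matrix.map_apply, Matrix.of_apply, if_neg hk', hg]
    rw [this, HahnSeries.coeff_single_mul, sub_zero, h1, mul_zero]
  have hd : CL c d i i = HahnSeries.single 1 (HahnSeries.single (d i) 1) +
      HahnSeries.single (-1) (HahnSeries.single (-d i) 1) := by
    simp only [CL, CR, Matrix.map_apply, Matrix.of_apply, if_true, map_add, iotaR_mon, neg_neg]
  rw [hs, add_zero, hd, add_mul, HahnSeries.coeff_add, HahnSeries.coeff_single_mul,
    HahnSeries.coeff_single_mul] at h3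
  have e1 : n - 1 - 1 = n - 2 := by ring
  have e2 : n - 1 - -1 = n := by ring
  rw [e1, e2, h2, mul_zero, zero_add] at h3
  refine (mul_eq_zero.1 h3).resolve_left ?_
  simp

theorem CL_low (c : I → I → ℤ) (d : I → ℤ) (x : I → LL) (M : ℤ)
    (h : ∀ i n, n < M → ((CL c d).mulVec x i).coeff n = 0) :
    ∀ i n, n < M + 1 → (x i).coeff n = 0 := by
  obtain ⟨m0, hm0⟩ : ∃ m0 : ℤ, ∀ i n, n < m0 → (x i).coeff n = 0 := by
    obtain ⟨m, hm⟩ := (Set.finite_range fun i => (x i).order).bddBelow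
    refine ⟨m, fun i n hn => HahnSeries.coeff_eq_zero_of_lt_order (lt_of_lt_of_le hn ?_)⟩
    exact hm ⟨i, rfl⟩
  have key : ∀ k : ℕ, ∀ n, n < m0 + k → n < M + 1 → ∀ i, (x i).coeff n = 0 := by
    intro k
    induction k with
    | zero => intro n hn _ i; exact hm0 i n (by simpa using hn)
    | succ k ih =>
      intro n hn hM i
      push_cast at hn
      exact CL_step c d x n i (fun j => ih _ (by omega) (by omega) j)
        (ih _ (by omega) (by omega) i) (h i _ (by omega))
  intro i n hn
  exact key (n - m0 + 1).toNat n (by omega) hn i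

theorem CL_det (c : I → I → ℤ) (d : I → ℤ) : (CL c d).det ≠ 0 := by
  intro h
  obtain ⟨v, hv, hv0⟩ := Matrix.exists_mulVec_eq_zero_iff.2 h
  apply hv
  funext i
  ext1
  funext n
  exact CL_low c d v n (fun i n _ => by rw [hv0]; simp) i n (by omega)

theorem CL_inv_low (c : I → I → ℤ) (d : I → ℤ) (X : Matrix I I LL) (hX : CL c d * X = 1)
    (i j : I) (u v : ℤ) (hv : 0 ≤ v) : dcoeff (X i j) u v = 0 := by
  have h := CL_low c d (fun k => X k j) 0 (by
    intro i n hn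
    have : (CL c d).mulVec (fun k => X k j) i = (CL c d * X) i j := rfl
    rw [this, hX, Matrix.one_apply]
    split_ifs
    · rw [HahnSeries.coeff_one, if_neg hn.ne]
    · rfl) i (-v) (by omega)
  unfold dcoeff
  rw [h]; rfl

theorem sigM_mul {R : Type} [CommRing R] {istar : I → I} (hinv : Function.Involutive istar)
    (A : Matrix I I R) (i j : I) : ((sigM istar : Matrix I I R) * A) i j = A (istar i) j := by
  have : ∀ k, (i = istar k) ↔ (k = istar i) := fun k =>
    ⟨fun h => by rw [h, hinv], fun h => by rw [h, hinv]⟩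
  simp [sigM, Matrix.mul_apply, this]

theorem mul_sigM {R : Type} [CommRing R] (istar : I → I)
    (A : Matrix I I R) (i j : I) : (A * (sigM istar : Matrix I I R)) i j = A i (istar j) := by
  simp [sigM, Matrix.mul_apply]

theorem CD.final [Nonempty I] (H : CD c d r) {θ : I → ℤ} (hθ : H.Hi θ)
    {l0 : List I} {istar : I → I}
    (hstar : ∀ i, actW c l0 (alphaZ i) = - alphaZ (istar i)) (hinv : Function.Involutive istar)
    (φ : KK →+* LL) (hφq : φ qv = qL) (hφt : φ tv = tL) (i j : I) (u v : ℤ)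
    (hv1 : -(1 + ∑ k, θ k) ≤ v) (hv2 : v ≤ 0) :
    dcoeff (φ ((Matrix.of (Cqt c d))⁻¹ i j))
          ((r + ∑ k, θ k * d k) - u) (-(1 + ∑ k, θ k) - v) =
        dcoeff (φ ((Matrix.of (Cqt c d))⁻¹ i (istar j))) u v := by
  obtain ⟨p, hp⟩ := H.main_R hθ hstar hinv
  set N := r + ∑ k, θ k * d k with hN
  set h := 1 + ∑ k, θ k with hh
  set X : Matrix I I LL := ((Matrix.of (Cqt c d))⁻¹).map φ with hX
  have hXe : ∀ i j, φ ((Matrix.of (Cqt c d))⁻¹ i j) = X i j := fun i j => rfl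
  rw [hXe, hXe]
  have hC := phi_Cqt H φ hφq hφt
  have hdet : IsUnit (Matrix.of (Cqt c d)).det := by
    rw [isUnit_iff_ne_zero]
    intro h0
    have := CL_det c d
    rw [← hC] at this
    apply this
    have e := RingHom.map_det φ (Matrix.of (Cqt c d))
    rw [h0, map_zero] at e
    exact e.symm
  have hCX : CL c d * X = 1 := by
    rw [← hC, hX, ← Matrix.map_mul, Matrix.mul_nonsing_inv _ hdet,
      Matrix.map_one φ (map_zero φ) (map_one φ)]
  have hlow := CL_inv_low c d X hCX
  -- star symmetry of the inverse
  have hXs : ∀ i j, X (istar i) j = X i (istar j) := by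
    have hXC : X * CL c d = 1 := mul_eq_one_comm.1 hCX
    have h1 : (sigM istar : Matrix I I LL) * CL c d = CL c d * sigM istar := by
      ext1 a b
      rw [sigM_mul hinv, mul_sigM]
      simp only [CL, Matrix.map_apply]
      rw [← H.star_CR hstar hinv, hinv]
    have h2 : (sigM istar : Matrix I I LL) * X = X * sigM istar := by
      calc sigM istar * X = X * CL c d * sigM istar * X := by rw [hXC, one_mul]
        _ = X * (sigM istar * CL c d) * X := by rw [h1, Matrix.mul_assoc X]
        _ = X * sigM istar := by rw [Matrix.mul_assoc, Matrix.mul_assoc, hCX, mul_one]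
    intro i j
    have e := congrFun (congrFun h2 i) j
    rw [sigM_mul hinv, mul_sigM] at e
    exact e
  -- the two expansions
  have expand : ∀ (p : Matrix I I RR) (a b : ℤ), p * CR c d = 1 + mon a b • sigM istar →
      ∀ i j, iotaR (p i j) = X i j + iotaR (mon a b) * X (istar i) j := by
    intro p a b hp i j
    have h1 : p.map iotaR * CL c d =
        1 + (Matrix.diagonal fun _ => iotaR (mon a b)) * sigM istar := by
      rw [CL, ← Matrix.map_mul, hp]
      ext1 k l
      simp only [Matrix.map_apply, Matrix.add_apply, Matrix.smul_apply, smul_eq_mul, map_add,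
        map_mul, sigM, Matrix.of_apply, Matrix.one_apply, Matrix.diagonal_mul]
      split_ifs <;> simp
    have h2 : p.map iotaR = X + (Matrix.diagonal fun _ => iotaR (mon a b)) * (sigM istar * X) := by
      calc p.map iotaR = p.map iotaR * CL c d * X := by rw [Matrix.mul_assoc, hCX, mul_one]
        _ = _ := by rw [h1, add_mul, one_mul, Matrix.mul_assoc]
    have h3 := congrFun (congrFun h2 i) j
    rw [Matrix.add_apply, Matrix.diagonal_mul, sigM_mul hinv] at h3
    exact h3
  have hpb : p.map barR * CR c d = 1 + mon N (-h) • sigM istar := by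
    have e : (CR c d).map barR = CR c d := by ext1 a b; exact CR_bar c d a b
    conv_lhs => rw [← e]
    rw [← Matrix.map_mul, hp]
    ext1 k l
    simp only [Matrix.map_apply, Matrix.add_apply, Matrix.smul_apply, smul_eq_mul, map_add,
      map_mul, sigM, Matrix.of_apply, Matrix.one_apply, barR_mon, neg_neg]
    split_ifs <;> simp
  have E1 := expand p _ _ hp
  have E2 := expand _ _ _ hpb
  -- coefficients of the inverse are coefficients of the polynomial
  have F1 : ∀ i j u v, -h ≤ v → dcoeff (X i j) u v = (p i j).coeff (-u, -v) := by
    intro i j u v hv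
    have h1 := congrArg (fun y => dcoeff y u v) (E2 i j)
    simp only [dcoeff_add, dcoeff_mon_mul, Matrix.map_apply, iotaR_coeff, barR_coeff] at h1
    rw [hlow (istar i) j (u - N) (v - -h) (by omega), add_zero] at h1
    exact h1.symm
  have F2 : ∀ i j u v, (p i j).coeff (-u, -v) = (p (istar i) j).coeff (u - N, v + h) := by
    intro i j u v
    have h1 : iotaR (barR (p i j)) = iotaR (mon N (-h)) * iotaR (p (istar i) j) := by
      have := E2 i j
      rw [Matrix.map_apply] at this
      rw [this, E1, hinv, mul_add, ← mul_assoc, ← map_mul, mon_mul]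
      simp [mon_zero, add_comm]
    have h2 := congrArg (fun y => dcoeff y u v) h1
    simp only [dcoeff_mon_mul, iotaR_coeff, barR_coeff, sub_neg_eq_add] at h2
    exact h2
  rw [F1 i j _ _ (by omega), ← hXs, F1 (istar i) j _ _ hv1, F2 (istar i) j, hinv]
  congr 2
  · ring
  · ring

end

theorem statement_13
    {I : Type} [Fintype I] [DecidableEq I] [Nonempty I]
    (c : I → I → ℤ) (d : I → ℤ) (r : ℤ)
    -- `C` is a symmetrizable generalized Cartan matrix
    (hdiag : ∀ i, c i i = 2)
    (hoff : ∀ i j, i ≠ j → c i j ≤ 0)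
    -- `(d_i)` are positive integers with gcd 1 symmetrizing `C`
    (hdpos : ∀ i, 0 < d i)
    (hgcd : Finset.univ.gcd d = 1)
    (hsymm : ∀ i j, d i * c i j = d j * c j i)
    -- each `d_i ∈ {1, r}` where `r = max_i d_i`
    (honer : ∀ i, d i = 1 ∨ d i = r)
    (hrmax : ∀ i, d i ≤ r)
    (hrmem : ∃ i, d i = r)
    -- `d_i c_{ij} = -max(d_i, d_j)` whenever `i ≠ j` and `c_{ij} ≠ 0`
    (hbmax : ∀ i j, i ≠ j → c i j ≠ 0 → d i * c i j = -(max (d i) (d j)))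
    -- `C` is indecomposable
    (hconn : ∀ i j : I, Relation.ReflTransGen (fun a b => a ≠ b ∧ c a b ≠ 0) i j)
    -- `C` is of finite type: the Weyl group is finite
    (hWfin : {w : (I → ℤ) → (I → ℤ) | memW c w}.Finite)
    -- `θ = Σ a_i α_i` is the highest root: `θ ∈ Φ` and `θ - β ∈ Q₊` for all `β ∈ Φ`;
    -- then `h = 1 + Σ a_i` and `N = r + Σ a_i d_i = r h^∨`
    (θ : I → ℤ)
    (hθΦ : ∃ w, memW c w ∧ ∃ i, θ = w (alphaZ i))
    (hθhigh : ∀ β : I → ℤ, (∃ w, memW c w ∧ ∃ i, β = w (alphaZ i)) → ∀ k, β k ≤ θ k)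
    -- `w₀` is the longest element: `w₀ ∈ W` with `w₀(α_i) ∈ -Q₊` for all `i`,
    -- and `i ↦ i^*` is the involution with `w₀(α_i) = -α_{i^*}`
    (w0 : (I → ℤ) → (I → ℤ))
    (hw0W : memW c w0)
    (hw0neg : ∀ i k, w0 (alphaZ i) k ≤ 0)
    (istar : I → I)
    (hstar : ∀ i, w0 (alphaZ i) = -alphaZ (istar i))
    (hstarinv : Function.Involutive istar)
    -- `φ` is the double Laurent expansion of `ℚ(q,t)`: first in `t⁻¹` (at `t = ∞`),
    -- then at `q = 0`; it is the unique ring homomorphism `ℚ(q,t) → ℚ((q))((t⁻¹))`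
    -- sending `q`, `t` to their canonical images
    (φ : KK →+* LL)
    (hφq : φ qv = qL)
    (hφt : φ tv = tL)
    :
    ∀ (i j : I) (u v : ℤ), 0 ≤ u → u ≤ r + ∑ k, θ k * d k →
      -(1 + ∑ k, θ k) ≤ v → v ≤ 0 →
      dcoeff (φ ((Matrix.of (Cqt c d))⁻¹ i j))
          ((r + ∑ k, θ k * d k) - u) (-(1 + ∑ k, θ k) - v) =
        dcoeff (φ ((Matrix.of (Cqt c d))⁻¹ i (istar j))) u v
    := by
  have H : CD c d r := ⟨hdiag, hoff, hdpos, hsymm, honer, hrmax, hrmem, hbmax, hconn, hWfin⟩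
  obtain ⟨l0, rfl⟩ := (memW_iff w0).1 hw0W
  have hθ : H.Hi θ := by
    refine ⟨?_, ?_⟩
    · obtain ⟨w, hw, i, e⟩ := hθΦ
      obtain ⟨l, rfl⟩ := (memW_iff w).1 hw
      exact ⟨l, i, e⟩
    · rintro β ⟨l, i, e⟩ k
      exact hθhigh β ⟨actW c l, (memW_iff _).2 ⟨l, rfl⟩, i, e⟩ k
  intro i j u v _ _ hv1 hv2
  exact H.final hθ hstar hstarinv φ hφq hφt i j u v hv1 hv2
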